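/- Let q be an odd prime power, j ∈ {1,…,q}\{(q+1)/2}, k ∈ {1,…,q−2}\{(q−1)/2}, and V₄ = S_j ∪ E_k. Then there are precisely (q+1)(q²+1) lines of PG(3,q²) entirely contained in V₄; no such line passes through a point of S_j \ O, exactly two such lines pass through each point of E_k \ O, and exactly q+1 such lines pass through each point of O. Moreover, the action of the group G of projectivities of PG(3,q²) induced by the matrices A^q ⊗ A with A ∈ GL(2,𝔽_{q²}) has exactly q + 4 orbits on the points of PG(3,q²). -/

import Mathlib

noncomputable section

open Matrix

/-- The points of `PG(3,q²)`: the projectivization of `F⁴` where `F = 𝔽_{q²}`. -/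
abbrev PGPoint (F : Type*) [Field F] := Projectivization F (Fin 4 → F)

/-- The form `F_γ(X₁,X₂,X₃,X₄) = X₁^q X₄ + X₁ X₄^q − X₂^{q+1} − X₃^{q+1}
    − γ (X₁X₄ − X₂X₃)^{(q+1)/2}`. -/
def Fgam {F : Type*} [Field F] (q : ℕ) (γ : F) (x : Fin 4 → F) : F :=
  x 0 ^ q * x 3 + x 0 * x 3 ^ q - x 1 ^ (q + 1) - x 2 ^ (q + 1)
    - γ * (x 0 * x 3 - x 1 * x 2) ^ ((q + 1) / 2)

/-- The point set `C_γ` of `PG(3,q²)`, the zero locus of `F_γ`. -/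
def Cgam {F : Type*} [Field F] (q : ℕ) (γ : F) : Set (PGPoint F) :=
  {P | ∀ (v : Fin 4 → F) (hv : v ≠ 0), P = Projectivization.mk F v hv → Fgam q γ v = 0}

/-- Kronecker product of two 2×2 matrices, as a 4×4 matrix. -/
def kron {F : Type*} [Field F] (A B : Matrix (Fin 2) (Fin 2) F) :
    Matrix (Fin 4) (Fin 4) F :=
  Matrix.of fun i j =>
    A ⟨i.val / 2, by have := i.isLt; omega⟩ ⟨j.val / 2, by have := j.isLt; omega⟩ *
    B ⟨i.val % 2, by have := i.isLt; omega⟩ ⟨j.val % 2, by have := j.isLt; omega⟩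

/-- Entrywise `q`-th power (the matrix `A^q`). -/
def matq {F : Type*} [Field F] (q : ℕ) (A : Matrix (Fin 2) (Fin 2) F) :
    Matrix (Fin 2) (Fin 2) F :=
  A.map (· ^ q)

/-- The orbit of a point of `PG(3,q²)` under the group `K ≅ PSL(2,q²)` of projectivities
    induced by the matrices `A^q ⊗ A` with `A ∈ SL(2,𝔽_{q²})`. -/
def Korb {F : Type*} [Field F] (q : ℕ) (P : PGPoint F) : Set (PGPoint F) :=
  {P' | ∃ A : Matrix (Fin 2) (Fin 2) F, A.det = 1 ∧
    ∃ (v : Fin 4 → F) (hv : v ≠ 0) (hw : Matrix.vecMul v (kron (matq q A) A) ≠ 0),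
      P = Projectivization.mk F v hv ∧ P' = Projectivization.mk F _ hw}

/-- The orbit of a point of `PG(3,q²)` under the group `G ≅ PGL(2,q²)` of projectivities
    induced by the matrices `A^q ⊗ A` with `A ∈ GL(2,𝔽_{q²})`. -/
def Gorb {F : Type*} [Field F] (q : ℕ) (P : PGPoint F) : Set (PGPoint F) :=
  {P' | ∃ A : Matrix (Fin 2) (Fin 2) F, A.det ≠ 0 ∧
    ∃ (v : Fin 4 → F) (hv : v ≠ 0) (hw : Matrix.vecMul v (kron (matq q A) A) ≠ 0),
      P = Projectivization.mk F v hv ∧ P' = Projectivization.mk F _ hw}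

/-- The Hermitian Veronese curve `O = {(1,t,t^q,t^{q+1})} ∪ {(0,0,0,1)}`. -/
def Oset (F : Type*) [Field F] (q : ℕ) : Set (PGPoint F) :=
  {P | (∃ (t : F) (hv : ![1, t, t ^ q, t ^ (q + 1)] ≠ 0),
        P = Projectivization.mk F _ hv) ∨
    ∃ (hv : (![0, 0, 0, 1] : Fin 4 → F) ≠ 0), P = Projectivization.mk F _ hv}

/-- The Baer subgeometry `Σ = {(a,b,b^q,c) : a,c ∈ 𝔽_q, b ∈ 𝔽_{q²}}`. -/
def SigmaSet (F : Type*) [Field F] (q : ℕ) : Set (PGPoint F) :=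
  {P | ∃ (a b c : F) (hv : ![a, b, b ^ q, c] ≠ 0),
    a ^ q = a ∧ c ^ q = c ∧ P = Projectivization.mk F _ hv}

/-- The hyperbolic quadric `Q⁺(3,q²) : X₁X₄ − X₂X₃ = 0`. -/
def Qplus (F : Type*) [Field F] : Set (PGPoint F) :=
  {P | ∀ (v : Fin 4 → F) (hv : v ≠ 0), P = Projectivization.mk F v hv →
    v 0 * v 3 - v 1 * v 2 = 0}

/-- A line of `PG(3,q²)`: the set of points lying in a 2-dimensional subspace. -/
def IsLine {F : Type*} [Field F] (ℓ : Set (PGPoint F)) : Prop :=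
  ∃ W : Submodule F (Fin 4 → F), Module.finrank F W = 2 ∧ ℓ = {P | P.rep ∈ W}

/-- A plane of `PG(3,q²)`: the set of points lying in a 3-dimensional subspace. -/
def IsPlane {F : Type*} [Field F] (π : Set (PGPoint F)) : Prop :=
  ∃ W : Submodule F (Fin 4 → F), Module.finrank F W = 3 ∧ π = {P | P.rep ∈ W}

/-! ### Sesquilinear forms in two variables

A vector `x` of length four is read as the `2 × 2` Gram matrix of a sesquilinear form with respect
to a field involution `σ`. -/

/-- The sesquilinear form with Gram matrix `x`. -/
def sesq {F : Type*} [Field F] (σ : F →+* F) (x : Fin 4 → F) (u v : Fin 2 → F) : F :=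
  σ (u 0) * v 0 * x 0 + σ (u 0) * v 1 * x 1 + σ (u 1) * v 0 * x 2 + σ (u 1) * v 1 * x 3

/-- The determinant of the matrix with columns `u` and `v`. -/
def wedge {F : Type*} [Field F] (u v : Fin 2 → F) : F := u 0 * v 1 - u 1 * v 0

/-- The Gram matrix of the form `x` in the basis `u`, `v`. -/
def twist {F : Type*} [Field F] (σ : F →+* F) (u v : Fin 2 → F) (x : Fin 4 → F) : Fin 4 → F :=
  ![sesq σ x u u, sesq σ x u v, sesq σ x v u, sesq σ x v v]

/-- The determinant of the Gram matrix `x`. -/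
def gramDet {F : Type*} [Field F] (x : Fin 4 → F) : F := x 0 * x 3 - x 1 * x 2

/-- The Hermitian form `X₁^σ X₄ + X₁ X₄^σ − X₂ X₂^σ − X₃ X₃^σ`. -/
def herm {F : Type*} [Field F] (σ : F →+* F) (x : Fin 4 → F) : F :=
  σ (x 0) * x 3 + x 0 * σ (x 3) - x 1 * σ (x 1) - x 2 * σ (x 2)

/-- The conjugation of a quadratic extension of finite fields of odd characteristic. -/
structure IsFiniteConj {F : Type*} [Field F] (σ : F →+* F) : Prop where
  invol : ∀ x, σ (σ x) = x
  two_ne_zero : (2 : F) ≠ 0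
  exists_norm_eq : ∀ y, σ y = y → ∃ x, x * σ x = y
  exists_sq_eq : ∀ y, σ y = y → ∃ x, x ^ 2 = y
  exists_skew : ∃ t, t ≠ 0 ∧ σ t = -t

section Sesquilinear

variable {F : Type*} [Field F] {σ : F →+* F}

lemma twist_smul (u v : Fin 2 → F) (a : F) (x : Fin 4 → F) :
    twist σ u v (a • x) = a • twist σ u v x := by
  funext i
  fin_cases i <;> simp [twist, sesq] <;> ring

lemma twist_add (u v : Fin 2 → F) (x y : Fin 4 → F) :
    twist σ u v (x + y) = twist σ u v x + twist σ u v y := by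
  funext i
  fin_cases i <;> simp [twist, sesq] <;> ring

lemma sesq_smul (a : F) (x : Fin 4 → F) (u v : Fin 2 → F) :
    sesq σ (a • x) u v = a * sesq σ x u v := by
  simp [sesq]; ring

lemma sesq_twist (u v a b : Fin 2 → F) (x : Fin 4 → F) :
    sesq σ (twist σ u v x) a b = sesq σ x (a 0 • u + a 1 • v) (b 0 • u + b 1 • v) := by
  simp [twist, sesq]; ring

lemma twist_twist (u v a b : Fin 2 → F) (x : Fin 4 → F) :
    twist σ a b (twist σ u v x) =
      twist σ (a 0 • u + a 1 • v) (b 0 • u + b 1 • v) x := by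
  funext i
  fin_cases i <;> simp [twist, sesq] <;> ring

lemma wedge_comp (u v a b : Fin 2 → F) :
    wedge (a 0 • u + a 1 • v) (b 0 • u + b 1 • v) = wedge a b * wedge u v := by
  simp [wedge]; ring

lemma twist_adjugate (u v : Fin 2 → F) (x : Fin 4 → F) :
    twist σ ![v 1, -u 1] ![-v 0, u 0] (twist σ u v x) = (wedge u v * σ (wedge u v)) • x := by
  funext i
  fin_cases i <;> simp [twist, sesq, wedge] <;> ring

lemma twist_adjugate' (u v : Fin 2 → F) (x : Fin 4 → F) :
    twist σ u v (twist σ ![v 1, -u 1] ![-v 0, u 0] x) = (wedge u v * σ (wedge u v)) • x := by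
  funext i
  fin_cases i <;> simp [twist, sesq, wedge] <;> ring

lemma gramDet_smul (a : F) (x : Fin 4 → F) : gramDet (a • x) = a ^ 2 * gramDet x := by
  simp [gramDet]; ring

lemma gramDet_twist (u v : Fin 2 → F) (x : Fin 4 → F) :
    gramDet (twist σ u v x) = wedge u v * σ (wedge u v) * gramDet x := by
  simp [gramDet, twist, sesq, wedge]; ring

lemma herm_smul (a : F) (x : Fin 4 → F) : herm σ (a • x) = a * σ a * herm σ x := by
  simp [herm]; ring

lemma herm_twist (hσ : IsFiniteConj σ) (u v : Fin 2 → F) (x : Fin 4 → F) :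
    herm σ (twist σ u v x) = wedge u v * σ (wedge u v) * herm σ x := by
  simp [herm, twist, sesq, wedge, hσ.invol]; ring

lemma conj_herm (hσ : IsFiniteConj σ) (x : Fin 4 → F) : σ (herm σ x) = herm σ x := by
  simp [herm, hσ.invol]; ring

/-- Hilbert's Theorem 90. -/
lemma exists_conj_eq_mul (hσ : IsFiniteConj σ) {x : F} (hx : x * σ x = 1) :
    ∃ t, t ≠ 0 ∧ σ t = x * t := by
  by_cases h : x = -1
  · obtain ⟨t, ht, h'⟩ := hσ.exists_skew
    exact ⟨t, ht, by rw [h', h]; ring⟩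
  · refine ⟨1 + σ x, fun h0 => h ?_, ?_⟩
    · have := congrArg σ h0
      simp [hσ.invol] at this
      linear_combination this
    · simp only [map_add, map_one, hσ.invol]
      linear_combination -hx

lemma exists_conj_shift (hσ : IsFiniteConj σ) {c : F} (hc : c * σ c ≠ 1) (s : F) :
    ∃ a, σ a + c * a = s := by
  have h : 1 - c * σ c ≠ 0 := sub_ne_zero.2 (Ne.symm hc)
  have h' : σ (1 - c * σ c) = 1 - c * σ c := by simp [hσ.invol]; ring
  refine ⟨(σ s - σ c * s) / (1 - c * σ c), ?_⟩
  rw [map_div₀, h', map_sub, map_mul, hσ.invol, hσ.invol]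
  field_simp
  ring

/-- A vector with a prescribed wedge product. -/
lemma exists_wedge_eq_one {u : Fin 2 → F} (hu : u ≠ 0) : ∃ v, wedge u v = 1 := by
  by_cases h : u 0 = 0
  · have h1 : u 1 ≠ 0 := fun h1 => hu (by funext i; fin_cases i <;> simp [h, h1])
    exact ⟨![-(u 1)⁻¹, 0], by simp [wedge, h1]⟩
  · exact ⟨![0, (u 0)⁻¹], by simp [wedge, h]⟩

lemma ne_zero_of_wedge_ne_zero {u v : Fin 2 → F} (h : wedge u v ≠ 0) (a : Fin 2 → F)
    (ha : a ≠ 0) : a 0 • u + a 1 • v ≠ 0 := by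
  intro h0
  have e0 : a 0 * u 0 + a 1 * v 0 = 0 := by simpa using congrFun h0 0
  have e1 : a 0 * u 1 + a 1 * v 1 = 0 := by simpa using congrFun h0 1
  have h2 : a 0 * wedge u v = 0 := by
    unfold wedge; linear_combination v 1 * e0 - v 0 * e1
  have h3 : a 1 * wedge u v = 0 := by
    unfold wedge; linear_combination u 0 * e1 - u 1 * e0
  refine ha (funext fun i => ?_)
  fin_cases i
  · simpa [h] using h2
  · simpa [h] using h3

/-- An eigenvector of the pencil spanned by a form and its adjoint. -/
lemma exists_eigenvector (hσ : IsFiniteConj σ) (x : Fin 4 → F) {l : F}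
    (hl : gramDet x - l * herm σ x + l ^ 2 * σ (gramDet x) = 0) :
    ∃ u : Fin 2 → F, u ≠ 0 ∧ ∀ v, sesq σ x v u = l * σ (sesq σ x u v) := by
  have hdet : (!![x 0 - l * σ (x 0), x 1 - l * σ (x 2);
      x 2 - l * σ (x 1), x 3 - l * σ (x 3)] : Matrix (Fin 2) (Fin 2) F).det = 0 := by
    rw [Matrix.det_fin_two_of, ← hl]
    simp [gramDet, herm]
    ring
  obtain ⟨u, hu, h⟩ := Matrix.exists_mulVec_eq_zero_iff.2 hdet
  refine ⟨u, hu, fun v => ?_⟩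
  have h0 := congrFun h 0
  have h1 := congrFun h 1
  simp [Matrix.mulVec, dotProduct, Fin.sum_univ_two] at h0 h1
  simp only [sesq, map_add, map_mul, hσ.invol]
  linear_combination σ (v 0) * h0 + σ (v 1) * h1

end Sesquilinear

/-! ### Classification of forms up to congruence and scaling -/

/-- Congruence of Gram matrices up to a scalar. -/
def GramEquiv {F : Type*} [Field F] (σ : F →+* F) (x y : Fin 4 → F) : Prop :=
  ∃ u v : Fin 2 → F, wedge u v ≠ 0 ∧ ∃ m : F, m ≠ 0 ∧ y = m • twist σ u v x

/-- The form `x` has a nonzero isotropic vector. -/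
def IsIsotropic {F : Type*} [Field F] (σ : F →+* F) (x : Fin 4 → F) : Prop :=
  ∃ u : Fin 2 → F, u ≠ 0 ∧ sesq σ x u u = 0

/-- The form `x` is Hermitian up to a scalar. -/
def IsHermLike {F : Type*} [Field F] (σ : F →+* F) (x : Fin 4 → F) : Prop :=
  ∃ l : F, ∀ u v : Fin 2 → F, σ (sesq σ x v u) = l * sesq σ x u v

/-- The basic invariant of a nondegenerate form. -/
def gramInv {F : Type*} [Field F] (σ : F →+* F) (x : Fin 4 → F) : F :=
  herm σ x ^ 2 / (gramDet x * σ (gramDet x))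

open Classical in
/-- A complete invariant for congruence up to a scalar. -/
def gramClass {F : Type*} [Field F] (σ : F →+* F) (x : Fin 4 → F) : F ⊕ Fin 4 :=
  if gramDet x = 0 then (if herm σ x = 0 then .inr 0 else .inr 1)
  else if gramInv σ x = 0 ∧ ¬ IsIsotropic σ x then .inr 2
  else if gramInv σ x = 4 ∧ ¬ IsHermLike σ x then .inr 3
  else .inl (gramInv σ x)

section Classification

variable {F : Type*} [Field F] {σ : F →+* F} {x y z : Fin 4 → F}

lemma GramEquiv.refl (x : Fin 4 → F) : GramEquiv σ x x := by
  refine ⟨![1, 0], ![0, 1], by simp [wedge], 1, one_ne_zero, ?_⟩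
  funext i
  fin_cases i <;> simp [twist, sesq]

lemma GramEquiv.symm (h : GramEquiv σ x y) : GramEquiv σ y x := by
  obtain ⟨u, v, hw, m, hm, rfl⟩ := h
  refine ⟨![v 1, -u 1], ![-v 0, u 0], ?_, (m * (wedge u v * σ (wedge u v)))⁻¹, ?_, ?_⟩
  · convert hw using 1; simp [wedge]; ring
  · simp [hm, hw]
  · rw [twist_smul, twist_adjugate, smul_smul m, smul_smul, inv_mul_cancel₀, one_smul]
    simp [hm, hw]

lemma GramEquiv.trans (h : GramEquiv σ x y) (h' : GramEquiv σ y z) : GramEquiv σ x z := by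
  obtain ⟨u, v, hw, m, hm, rfl⟩ := h
  obtain ⟨a, b, hw', m', hm', rfl⟩ := h'
  refine ⟨a 0 • u + a 1 • v, b 0 • u + b 1 • v, ?_, m' * m, mul_ne_zero hm' hm, ?_⟩
  · rw [wedge_comp]; exact mul_ne_zero hw' hw
  · rw [twist_smul, twist_twist, smul_smul]

lemma gramEquiv_smul (x : Fin 4 → F) {m : F} (hm : m ≠ 0) : GramEquiv σ x (m • x) := by
  obtain ⟨u, v, hw, m', hm', h⟩ := GramEquiv.refl (σ := σ) x
  refine ⟨u, v, hw, m * m', mul_ne_zero hm hm', ?_⟩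
  rw [mul_smul, ← h]

lemma gramEquiv_twist (x : Fin 4 → F) {u v : Fin 2 → F} (hw : wedge u v ≠ 0) :
    GramEquiv σ x (twist σ u v x) :=
  ⟨u, v, hw, 1, one_ne_zero, by simp⟩

lemma gramEquiv_diag (x : Fin 4 → F) {a b : F} (ha : a ≠ 0) (hb : b ≠ 0) :
    GramEquiv σ x ![a * σ a * x 0, σ a * b * x 1, σ b * a * x 2, b * σ b * x 3] := by
  convert gramEquiv_twist (σ := σ) x (u := ![a, 0]) (v := ![0, b]) (by simp [wedge, ha, hb]) using 1
  funext i
  fin_cases i <;> simp [twist, sesq, mul_comm]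

lemma gramEquiv_swap (x : Fin 4 → F) : GramEquiv σ x ![x 3, x 2, x 1, x 0] := by
  convert gramEquiv_twist (σ := σ) x (u := ![0, 1]) (v := ![1, 0]) (by simp [wedge]) using 1
  funext i
  fin_cases i <;> simp [twist, sesq]

lemma gramEquiv_shear (x : Fin 4 → F) (a : F) (h0 : x 0 = 0) :
    GramEquiv σ x ![0, x 1, x 2, x 3 + σ a * x 1 + a * x 2] := by
  convert gramEquiv_twist (σ := σ) x (u := ![1, 0]) (v := ![a, 1]) (by simp [wedge]) using 1
  funext i
  fin_cases i <;> simp [twist, sesq, h0]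
  ring

lemma IsIsotropic.of_gramEquiv (hx : IsIsotropic σ y) (h : GramEquiv σ x y) :
    IsIsotropic σ x := by
  obtain ⟨u, v, hw, m, hm, rfl⟩ := h
  obtain ⟨a, ha, h⟩ := hx
  refine ⟨_, ne_zero_of_wedge_ne_zero hw a ha, ?_⟩
  rwa [sesq_smul, mul_eq_zero_iff_left hm, sesq_twist] at h

lemma IsHermLike.of_gramEquiv (hx : IsHermLike σ x) (h : GramEquiv σ x y) :
    IsHermLike σ y := by
  obtain ⟨u, v, hw, m, hm, rfl⟩ := h
  obtain ⟨l, hl⟩ := hx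
  refine ⟨σ m / m * l, fun a b => ?_⟩
  rw [sesq_smul, sesq_smul, sesq_twist, sesq_twist, map_mul, hl]
  field_simp

open Classical in
lemma gramClass_congr (hσ : IsFiniteConj σ) (h : GramEquiv σ x y) :
    gramClass σ x = gramClass σ y := by
  have hI : IsIsotropic σ x ↔ IsIsotropic σ y :=
    ⟨fun hx => hx.of_gramEquiv h.symm, fun hy => hy.of_gramEquiv h⟩
  have hH : IsHermLike σ x ↔ IsHermLike σ y :=
    ⟨fun hx => hx.of_gramEquiv h, fun hy => hy.of_gramEquiv h.symm⟩
  obtain ⟨u, v, hw, m, hm, rfl⟩ := h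
  have hw' : σ (wedge u v) ≠ 0 := by simpa using hw
  have hm' : σ m ≠ 0 := by simpa using hm
  have hd : gramDet (m • twist σ u v x) = m ^ 2 * (wedge u v * σ (wedge u v)) * gramDet x := by
    rw [gramDet_smul, gramDet_twist]; ring
  have hh : herm σ (m • twist σ u v x) = m * σ m * (wedge u v * σ (wedge u v)) * herm σ x := by
    rw [herm_smul, herm_twist hσ]; ring
  have hd0 : gramDet (m • twist σ u v x) = 0 ↔ gramDet x = 0 := by rw [hd]; simp [hm, hw]
  have hh0 : herm σ (m • twist σ u v x) = 0 ↔ herm σ x = 0 := by rw [hh]; simp [hm, hw]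
  have hi : gramInv σ (m • twist σ u v x) = gramInv σ x := by
    by_cases h0 : gramDet x = 0
    · simp [gramInv, hd0.2 h0, h0]
    · have h0' : σ (gramDet x) ≠ 0 := by simpa using h0
      unfold gramInv
      rw [hd, hh]
      simp only [map_mul, map_pow, hσ.invol]
      field_simp
  unfold gramClass
  rw [hi]
  exact if_congr hd0.symm (if_congr hh0.symm rfl rfl)
    (if_congr (and_congr_right fun _ => not_congr hI) rfl
      (if_congr (and_congr_right fun _ => not_congr hH) rfl rfl))

/-- Normal forms of isotropic sesquilinear forms. -/
lemma IsIsotropic.exists_normal_form (hσ : IsFiniteConj σ) (hx : IsIsotropic σ x) (h0 : x ≠ 0) :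
    GramEquiv σ x ![0, 0, 0, 1] ∨ GramEquiv σ x ![0, 1, 0, 0] ∨
      (∃ c, c ≠ 0 ∧ (c * σ c ≠ 1 ∨ c = 1) ∧ GramEquiv σ x ![0, 1, c, 0]) ∨
      ∃ t, t ≠ 0 ∧ σ t = -t ∧ GramEquiv σ x ![0, 1, 1, t] := by
  obtain ⟨u, hu, h⟩ := hx
  obtain ⟨v, hv⟩ := exists_wedge_eq_one hu
  have hw : wedge u v ≠ 0 := by simp [hv]
  have hxy := gramEquiv_twist (σ := σ) x hw
  have hy0 : twist σ u v x ≠ 0 := by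
    intro hy
    apply h0
    have := twist_adjugate (σ := σ) u v x
    rw [hy, hv] at this
    simpa [twist, sesq, funext_iff, Fin.forall_fin_succ] using this.symm
  have hy : twist σ u v x 0 = 0 := h
  generalize twist σ u v x = y at *
  clear h hv hw h0
  have key : ∀ z, GramEquiv σ y z → GramEquiv σ x z := fun z => hxy.trans
  by_cases h1 : y 1 = 0
  · by_cases h2 : y 2 = 0
    · left
      have h3 : y 3 ≠ 0 := fun h3 => hy0 (by funext i; fin_cases i <;> simpa)
      apply key
      convert gramEquiv_smul (σ := σ) y (inv_ne_zero h3) using 1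
      funext i; fin_cases i <;> simp [hy, h1, h2, h3]
    · right; left
      apply key
      refine (gramEquiv_shear y (-y 3 / y 2) hy).trans ((gramEquiv_swap _).trans ?_)
      convert gramEquiv_smul (σ := σ) _ (inv_ne_zero h2) using 1
      funext i; fin_cases i <;> simp [h1, h2]
  · by_cases h2 : y 2 = 0
    · right; left
      apply key
      refine (gramEquiv_shear y (σ (-y 3 / y 1)) hy).trans ?_
      convert gramEquiv_smul (σ := σ) _ (inv_ne_zero h1) using 1
      funext i; fin_cases i <;> simp [hσ.invol, h1, h2]
    · right; right
      have hyz := gramEquiv_smul (σ := σ) y (inv_ne_zero h1)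
      by_cases hN : (y 2 / y 1) * σ (y 2 / y 1) = 1
      · obtain ⟨a, ha, ha'⟩ := exists_conj_eq_mul hσ hN
        have hN' : y 2 * σ (y 2) = y 1 * σ (y 1) := by
          have h1' : σ (y 1) ≠ 0 := by simpa using h1
          rw [map_div₀] at hN
          field_simp at hN
          exact hN
        have hσa : σ a ≠ 0 := by simpa using ha
        have hyz := (gramEquiv_diag (σ := σ) y ha one_ne_zero).trans
          (gramEquiv_smul _ (inv_ne_zero (mul_ne_zero hσa h1)))
        set s := (σ a * y 1)⁻¹ * y 3 with hs
        have hz : GramEquiv σ y ![0, 1, 1, s] := by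
          convert hyz using 1
          have e : (y 1)⁻¹ * (σ a)⁻¹ * (a * y 2) = 1 := by rw [ha']; field_simp
          funext i; fin_cases i <;> simp [hy, hs, e]
          field_simp
        have h2' := hσ.two_ne_zero
        have hz' := hz.trans (gramEquiv_shear (σ := σ) ![0, 1, 1, s] (-(s + σ s) / 4) rfl)
        have h4 : (4 : F) ≠ 0 := by
          have : (4 : F) = 2 * 2 := by norm_num
          rw [this]; exact mul_ne_zero h2' h2'
        have hz'' : GramEquiv σ y ![0, 1, 1, (s - σ s) / 2] := by
          convert hz' using 1
          funext i; fin_cases i <;> simp [hσ.invol, map_ofNat]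
          field_simp
          ring
        by_cases ht : (s - σ s) / 2 = 0
        · left
          rw [ht] at hz''
          exact ⟨1, one_ne_zero, Or.inr rfl, key _ hz''⟩
        · right
          exact ⟨_, ht, by simp [hσ.invol, map_ofNat]; ring, key _ hz''⟩
      · left
        obtain ⟨a, ha⟩ := exists_conj_shift hσ hN (-(y 3 / y 1))
        refine ⟨y 2 / y 1, div_ne_zero h2 h1, Or.inl hN, key _ (hyz.trans ?_)⟩
        convert gramEquiv_shear (σ := σ) _ a _ using 1
        · funext i; fin_cases i <;> simp [h1]
          · field_simp
          · linear_combination -ha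
        · simp [hy]

lemma isIsotropic_diag (hσ : IsFiniteConj σ) {t : F} (ht : σ t = t) :
    IsIsotropic σ ![1, 0, 0, t] := by
  obtain ⟨a, ha⟩ := hσ.exists_norm_eq (-t) (by rw [map_neg, ht])
  refine ⟨![a, 1], by simp, ?_⟩
  simp [sesq]
  linear_combination ha

/-- Diagonalization of anisotropic sesquilinear forms. -/
lemma exists_diagonal_form (hσ : IsFiniteConj σ) (hx : ¬ IsIsotropic σ x) :
    ∃ t, σ t ≠ t ∧ GramEquiv σ x ![1, 0, 0, t] := by
  have hiso : ∀ u : Fin 2 → F, sesq σ x u u = 0 → u = 0 := fun u hu => by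
    by_contra h; exact hx ⟨u, h, hu⟩
  have hd : gramDet x ≠ 0 := by
    intro hd
    obtain ⟨u, hu, h⟩ := exists_eigenvector hσ x (l := 0) (by simp [hd])
    exact hu (hiso u (by simpa using h u))
  have hd' : σ (gramDet x) ≠ 0 := by simpa using hd
  obtain ⟨r, hr⟩ := hσ.exists_sq_eq (herm σ x ^ 2 - 4 * (gramDet x * σ (gramDet x)))
    (by simp [conj_herm hσ, hσ.invol, map_ofNat, mul_comm])
  have h2 := hσ.two_ne_zero
  obtain ⟨u, hu, h⟩ := exists_eigenvector hσ x (l := (herm σ x + r) / (2 * σ (gramDet x))) (by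
    field_simp
    linear_combination hr)
  have huu : sesq σ x u u ≠ 0 := fun h0 => hu (hiso u h0)
  set v : Fin 2 → F := ![σ (u 0) * x 1 + σ (u 1) * x 3, -(σ (u 0) * x 0 + σ (u 1) * x 2)] with hv
  have huv : sesq σ x u v = 0 := by simp [hv, sesq]; ring
  have hvu : sesq σ x v u = 0 := by simp [h v, huv]
  have hw : wedge u v ≠ 0 := by
    convert neg_ne_zero.2 huu using 1
    simp [hv, wedge, sesq]; ring
  have hequiv : GramEquiv σ x ![1, 0, 0, sesq σ x v v / sesq σ x u u] := by
    refine ⟨u, v, hw, _, inv_ne_zero huu, ?_⟩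
    funext i
    fin_cases i <;> simp [twist, huv, hvu, huu]
    ring
  exact ⟨_, fun ht => hx ((isIsotropic_diag hσ ht).of_gramEquiv hequiv), hequiv⟩

end Classification

section NormalForms

variable {F : Type*} [Field F] {σ : F →+* F} {x y : Fin 4 → F}

lemma gramClass_point : gramClass σ (![0, 0, 0, 1] : Fin 4 → F) = .inr 0 := by
  simp [gramClass, gramDet, herm]

lemma gramClass_rankOne : gramClass σ (![0, 1, 0, 0] : Fin 4 → F) = .inr 1 := by
  simp [gramClass, gramDet, herm]

lemma isIsotropic_of_zero (h : x 0 = 0) : IsIsotropic σ x :=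
  ⟨![1, 0], by simp, by simp [sesq, h]⟩

lemma gramInv_antidiag (c : F) :
    gramInv σ ![0, 1, c, 0] = (1 + c * σ c) ^ 2 / (c * σ c) := by
  simp [gramInv, gramDet, herm]
  ring

lemma gramInv_diag (t : F) : gramInv σ ![1, 0, 0, t] = (t + σ t) ^ 2 / (t * σ t) := by
  simp [gramInv, gramDet, herm]

lemma gramClass_antidiag (hσ : IsFiniteConj σ) {c : F} (hc : c ≠ 0) (h : c * σ c ≠ 1 ∨ c = 1) :
    gramClass σ ![0, 1, c, 0] = .inl ((1 + c * σ c) ^ 2 / (c * σ c)) := by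
  have hd : gramDet ![0, 1, c, 0] ≠ 0 := by simp [gramDet, hc]
  have hc' : σ c ≠ 0 := by simpa using hc
  unfold gramClass
  rw [if_neg hd, if_neg (fun h => h.2 (isIsotropic_of_zero rfl)), if_neg, gramInv_antidiag]
  rintro ⟨h4, hH⟩
  rw [gramInv_antidiag, div_eq_iff (mul_ne_zero hc hc')] at h4
  have h1 : c * σ c = 1 := by
    have : (c * σ c - 1) ^ 2 = 0 := by linear_combination h4
    exact sub_eq_zero.1 (pow_eq_zero_iff two_ne_zero |>.1 this)
  obtain rfl : c = 1 := h.resolve_left (not_not.2 h1)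
  exact hH ⟨1, fun u v => by simp [sesq, hσ.invol]; ring⟩

lemma gramClass_skew (hσ : IsFiniteConj σ) {t : F} (ht : t ≠ 0) (h : σ t = -t) :
    gramClass σ ![0, 1, 1, t] = .inr 3 := by
  have hd : gramDet ![0, 1, 1, t] ≠ 0 := by simp [gramDet]
  have h4 : gramInv σ ![0, 1, 1, t] = 4 := by simp [gramInv, gramDet, herm]; norm_num
  have hH : ¬ IsHermLike σ ![0, 1, 1, t] := by
    rintro ⟨l, hl⟩
    have h1 := hl ![1, 0] ![0, 1]
    have h2 := hl ![0, 1] ![0, 1]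
    simp [sesq] at h1 h2
    rw [← h1, h] at h2
    have : 2 * t = 0 := by linear_combination -h2
    simp [hσ.two_ne_zero, ht] at this
  unfold gramClass
  rw [if_neg hd, if_neg (fun h => h.2 (isIsotropic_of_zero rfl)), if_pos ⟨h4, hH⟩]

lemma not_isIsotropic_diag (hσ : IsFiniteConj σ) {t : F} (ht : σ t ≠ t) :
    ¬ IsIsotropic σ ![1, 0, 0, t] := by
  rintro ⟨u, hu, h⟩
  simp [sesq] at h
  have h' := congrArg σ h
  simp [hσ.invol] at h'
  have h1 : u 1 * σ (u 1) * (σ t - t) = 0 := by linear_combination h' - h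
  have h1 : u 1 = 0 := by simpa [sub_ne_zero.2 ht] using h1
  have h0 : u 0 = 0 := by simpa [h1] using h
  exact hu (by funext i; fin_cases i <;> simp [h0, h1])

open Classical in
lemma gramClass_diag (hσ : IsFiniteConj σ) {t : F} (ht : σ t ≠ t) :
    gramClass σ ![1, 0, 0, t] =
      if σ t = -t then .inr 2 else .inl ((t + σ t) ^ 2 / (t * σ t)) := by
  have h0 : t ≠ 0 := by rintro rfl; simp at ht
  have h0' : σ t ≠ 0 := by simpa using h0
  have hd : gramDet ![1, 0, 0, t] ≠ 0 := by simp [gramDet, h0]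
  have hI : gramInv σ ![1, 0, 0, t] = 0 ↔ σ t = -t := by
    rw [gramInv_diag]
    simp only [div_eq_zero_iff, mul_eq_zero, h0, h0', or_false, pow_eq_zero_iff two_ne_zero]
    constructor <;> intro h <;> linear_combination h
  unfold gramClass
  rw [if_neg hd]
  by_cases h : σ t = -t
  · rw [if_pos h, if_pos ⟨hI.2 h, not_isIsotropic_diag hσ ht⟩]
  · rw [if_neg h, if_neg (fun h' => h (hI.1 h'.1)), if_neg, gramInv_diag]
    rintro ⟨h4, -⟩
    rw [gramInv_diag, div_eq_iff (mul_ne_zero h0 h0')] at h4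
    have : (σ t - t) ^ 2 = 0 := by linear_combination h4
    exact ht (sub_eq_zero.1 (pow_eq_zero_iff two_ne_zero |>.1 this))

lemma gramEquiv_antidiag_of_norm_eq (hσ : IsFiniteConj σ) {c d : F} (hc : c ≠ 0)
    (h : c * σ c = d * σ d) : GramEquiv σ ![0, 1, c, 0] ![0, 1, d, 0] := by
  have hc' : σ c ≠ 0 := by simpa using hc
  have hd : d ≠ 0 := by rintro rfl; simp [hc] at h
  have hd' : σ d ≠ 0 := by simpa using hd
  obtain ⟨a, ha, h1⟩ := exists_conj_eq_mul hσ (x := c / d) (by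
    rw [map_div₀]; field_simp; exact h)
  have ha' : σ a ≠ 0 := by simpa using ha
  convert (gramEquiv_diag (σ := σ) ![0, 1, c, 0] ha one_ne_zero).trans
    (gramEquiv_smul _ (inv_ne_zero ha')) using 1
  funext i
  fin_cases i <;> simp [ha]
  rw [h1]
  field_simp

lemma gramEquiv_antidiag_of_gramInv_eq (hσ : IsFiniteConj σ) {c d : F} (hc : c ≠ 0) (hd : d ≠ 0)
    (h : (1 + c * σ c) ^ 2 / (c * σ c) = (1 + d * σ d) ^ 2 / (d * σ d)) :
    GramEquiv σ ![0, 1, c, 0] ![0, 1, d, 0] := by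
  have hc' : σ c ≠ 0 := by simpa using hc
  have hd' : σ d ≠ 0 := by simpa using hd
  rw [div_eq_div_iff (mul_ne_zero hc hc') (mul_ne_zero hd hd')] at h
  have : (c * σ c - d * σ d) * (c * σ c * (d * σ d) - 1) = 0 := by linear_combination h
  rcases mul_eq_zero.1 this with h | h
  · exact gramEquiv_antidiag_of_norm_eq hσ hc (sub_eq_zero.1 h)
  · have e : GramEquiv σ ![0, 1, c, 0] ![0, 1, c⁻¹, 0] := by
      convert (gramEquiv_swap (σ := σ) ![0, 1, c, 0]).trans
        (gramEquiv_smul _ (inv_ne_zero hc)) using 1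
      funext i
      fin_cases i <;> simp [hc]
    refine e.trans (gramEquiv_antidiag_of_norm_eq hσ (inv_ne_zero hc) ?_)
    rw [map_inv₀]
    field_simp
    linear_combination -h

lemma gramEquiv_diag_of_ratio (hσ : IsFiniteConj σ) {s t : F} (hs : s ≠ 0) (ht : t ≠ 0)
    (h : s * σ t = σ s * t) : GramEquiv σ ![1, 0, 0, s] ![1, 0, 0, t] := by
  have hs' : σ s ≠ 0 := by simpa using hs
  obtain ⟨b, hb⟩ := hσ.exists_norm_eq (t / s) (by
    rw [map_div₀]; field_simp; linear_combination h)
  have hb0 : b ≠ 0 := by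
    rintro rfl
    exact div_ne_zero ht hs (by simpa using hb.symm)
  convert gramEquiv_diag (σ := σ) ![1, 0, 0, s] one_ne_zero hb0 using 1
  funext i
  fin_cases i <;> simp [hb, hs]

lemma gramEquiv_diag_of_gramInv_eq (hσ : IsFiniteConj σ) {s t : F} (hs : s ≠ 0) (ht : t ≠ 0)
    (h : (s + σ s) ^ 2 / (s * σ s) = (t + σ t) ^ 2 / (t * σ t)) :
    GramEquiv σ ![1, 0, 0, s] ![1, 0, 0, t] := by
  have hs' : σ s ≠ 0 := by simpa using hs
  have ht' : σ t ≠ 0 := by simpa using ht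
  rw [div_eq_div_iff (mul_ne_zero hs hs') (mul_ne_zero ht ht')] at h
  have : (s * σ t - σ s * t) * (s * t - σ s * σ t) = 0 := by linear_combination h
  rcases mul_eq_zero.1 this with h | h
  · exact gramEquiv_diag_of_ratio hσ hs ht (sub_eq_zero.1 h)
  · have e : GramEquiv σ ![1, 0, 0, s] ![1, 0, 0, s⁻¹] := by
      convert (gramEquiv_swap (σ := σ) ![1, 0, 0, s]).trans
        (gramEquiv_smul _ (inv_ne_zero hs)) using 1
      funext i
      fin_cases i <;> simp [hs]
    refine e.trans (gramEquiv_diag_of_ratio hσ (inv_ne_zero hs) ht ?_)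
    rw [map_inv₀]
    field_simp
    linear_combination -h

lemma gramEquiv_skew {s t : F} (hs : s ≠ 0) (ht : t ≠ 0)
    (hs' : σ s = -s) (ht' : σ t = -t) : GramEquiv σ ![0, 1, 1, s] ![0, 1, 1, t] := by
  have hst : s / t ≠ 0 := div_ne_zero hs ht
  have hfix : σ (s / t) = s / t := by rw [map_div₀, hs', ht', neg_div_neg_eq]
  convert (gramEquiv_diag (σ := σ) ![0, 1, 1, s] hst one_ne_zero).trans
    (gramEquiv_smul _ (inv_ne_zero hst)) using 1
  funext i
  fin_cases i <;> simp only [hfix] <;> simp [hs, ht]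

lemma antidiag_ne_diag (hσ : IsFiniteConj σ) {c t : F} (hc : c ≠ 0) (ht : σ t ≠ t)
    (ht' : σ t ≠ -t) :
    (1 + c * σ c) ^ 2 / (c * σ c) ≠ (t + σ t) ^ 2 / (t * σ t) := by
  intro h
  have h0 : t ≠ 0 := by rintro rfl; simp at ht
  have h0' : σ t ≠ 0 := by simpa using h0
  have hc' : σ c ≠ 0 := by simpa using hc
  rw [div_eq_div_iff (mul_ne_zero hc hc') (mul_ne_zero h0 h0')] at h
  have key : ∀ s, s ≠ 0 → c * σ c * s = σ s → σ s = s ∨ σ s = -s := by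
    intro s hs hN
    have h1 := congrArg σ hN
    simp only [map_mul, hσ.invol] at h1
    have h2 : (σ s - s) * (σ s + s) = 0 := by
      linear_combination s * h1 - σ s * hN
    rcases mul_eq_zero.1 h2 with h | h
    · exact Or.inl (sub_eq_zero.1 h)
    · exact Or.inr (eq_neg_of_add_eq_zero_left h)
  have : (c * σ c * t - σ t) * (c * σ c * σ t - t) = 0 := by linear_combination h
  rcases mul_eq_zero.1 this with h | h
  · exact (key t h0 (sub_eq_zero.1 h)).elim ht ht'
  · rcases key (σ t) h0' (by rw [hσ.invol]; exact sub_eq_zero.1 h) with h | h <;>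
      rw [hσ.invol] at h
    · exact ht h.symm
    · exact ht' (by linear_combination h)

/-- The normal forms, together with their invariants. -/
lemma exists_normal_form (hσ : IsFiniteConj σ) (hx : x ≠ 0) :
    (gramClass σ x = .inr 0 ∧ GramEquiv σ x ![0, 0, 0, 1]) ∨
    (gramClass σ x = .inr 1 ∧ GramEquiv σ x ![0, 1, 0, 0]) ∨
    (∃ t, gramClass σ x = .inr 2 ∧ t ≠ 0 ∧ σ t = -t ∧ GramEquiv σ x ![1, 0, 0, t]) ∨
    (∃ t, gramClass σ x = .inr 3 ∧ t ≠ 0 ∧ σ t = -t ∧ GramEquiv σ x ![0, 1, 1, t]) ∨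
    (∃ c, gramClass σ x = .inl ((1 + c * σ c) ^ 2 / (c * σ c)) ∧ c ≠ 0 ∧
      GramEquiv σ x ![0, 1, c, 0]) ∨
    ∃ t, gramClass σ x = .inl ((t + σ t) ^ 2 / (t * σ t)) ∧ σ t ≠ t ∧ σ t ≠ -t ∧
      GramEquiv σ x ![1, 0, 0, t] := by
  by_cases hI : IsIsotropic σ x
  · rcases hI.exists_normal_form hσ hx with h | h | ⟨c, hc, hc', h⟩ | ⟨t, ht, ht', h⟩
    · exact Or.inl ⟨(gramClass_congr hσ h).trans gramClass_point, h⟩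
    · exact Or.inr (Or.inl ⟨(gramClass_congr hσ h).trans gramClass_rankOne, h⟩)
    · exact Or.inr (Or.inr (Or.inr (Or.inr (Or.inl
        ⟨c, (gramClass_congr hσ h).trans (gramClass_antidiag hσ hc hc'), hc, h⟩))))
    · exact Or.inr (Or.inr (Or.inr (Or.inl
        ⟨t, (gramClass_congr hσ h).trans (gramClass_skew hσ ht ht'), ht, ht', h⟩)))
  · obtain ⟨t, ht, h⟩ := exists_diagonal_form hσ hI
    have ht0 : t ≠ 0 := by rintro rfl; simp at ht
    have hc := (gramClass_congr hσ h).trans (gramClass_diag hσ ht)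
    by_cases h' : σ t = -t
    · exact Or.inr (Or.inr (Or.inl ⟨t, by rw [hc, if_pos h'], ht0, h', h⟩))
    · exact Or.inr (Or.inr (Or.inr (Or.inr (Or.inr ⟨t, by rw [hc, if_neg h'], ht, h', h⟩))))

lemma gramEquiv_of_gramClass_eq (hσ : IsFiniteConj σ) (hx : x ≠ 0) (hy : y ≠ 0)
    (h : gramClass σ x = gramClass σ y) : GramEquiv σ x y := by
  have hne : ∀ t : F, σ t ≠ t → t ≠ 0 := by rintro t ht rfl; simp at ht
  suffices ∀ x' y', GramEquiv σ x x' → GramEquiv σ y y' → GramEquiv σ x' y' →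
      GramEquiv σ x y by
    rcases exists_normal_form hσ hx with ⟨kx, ex⟩ | ⟨kx, ex⟩ | ⟨s, kx, hs, hs', ex⟩ |
      ⟨s, kx, hs, hs', ex⟩ | ⟨c, kx, hc, ex⟩ | ⟨s, kx, hs, hs', ex⟩ <;>
    rcases exists_normal_form hσ hy with ⟨ky, ey⟩ | ⟨ky, ey⟩ | ⟨t, ky, ht, ht', ey⟩ |
      ⟨t, ky, ht, ht', ey⟩ | ⟨d, ky, hd, ey⟩ | ⟨t, ky, ht, ht', ey⟩ <;>
    rw [kx, ky] at h <;> try (exfalso; simp at h; done)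
    · exact this _ _ ex ey (GramEquiv.refl _)
    · exact this _ _ ex ey (GramEquiv.refl _)
    · exact this _ _ ex ey (gramEquiv_diag_of_ratio hσ hs ht (by rw [hs', ht']; ring))
    · exact this _ _ ex ey (gramEquiv_skew hs ht hs' ht')
    · exact this _ _ ex ey (gramEquiv_antidiag_of_gramInv_eq hσ hc hd (Sum.inl.inj h))
    · exact absurd (Sum.inl.inj h) (antidiag_ne_diag hσ hc ht ht')
    · exact absurd (Sum.inl.inj h).symm (antidiag_ne_diag hσ hd hs hs')
    · exact this _ _ ex ey
        (gramEquiv_diag_of_gramInv_eq hσ (hne _ hs) (hne _ ht) (Sum.inl.inj h))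
  intro x' y' ex ey h'
  exact (ex.trans h').trans ey.symm

/-- The classes of nonzero forms. -/
lemma range_gramClass (hσ : IsFiniteConj σ) :
    gramClass σ '' {x | x ≠ 0} = Sum.inl '' {a | σ a = a} ∪ Set.range Sum.inr := by
  have hne : ∀ t : F, σ t ≠ t → t ≠ 0 := by rintro t ht rfl; simp at ht
  obtain ⟨t, ht0, ht⟩ := hσ.exists_skew
  have ht' : σ t ≠ t := by
    intro h
    have : 2 * t = 0 := by linear_combination ht - h
    simp [hσ.two_ne_zero, ht0] at this
  apply Set.Subset.antisymm
  · rintro _ ⟨x, hx, rfl⟩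
    rcases exists_normal_form hσ hx with ⟨kx, -⟩ | ⟨kx, -⟩ | ⟨s, kx, -⟩ | ⟨s, kx, -⟩ |
      ⟨c, kx, -⟩ | ⟨s, kx, -⟩ <;> rw [kx]
    any_goals exact Or.inr ⟨_, rfl⟩
    · exact Or.inl ⟨_, by simp [hσ.invol, mul_comm], rfl⟩
    · exact Or.inl ⟨_, by simp [hσ.invol, mul_comm, add_comm], rfl⟩
  · rintro _ (⟨a, ha, rfl⟩ | ⟨i, rfl⟩)
    · have ha : σ a = a := ha
      have h2 := hσ.two_ne_zero
      obtain ⟨r, hr⟩ := hσ.exists_sq_eq (a ^ 2 - 4 * a) (by simp [ha, map_ofNat])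
      obtain ⟨w, hw⟩ : ∃ w, w = (a - 2 + r) / 2 := ⟨_, rfl⟩
      have hq : w ^ 2 - (a - 2) * w + 1 = 0 := by
        rw [hw]; field_simp; linear_combination hr
      have hw0 : w ≠ 0 := by rintro rfl; simp at hq
      by_cases hfix : σ w = w
      · by_cases h1 : w = 1
        · have h4 : a = 4 := by rw [h1] at hq; linear_combination -hq
          refine ⟨![0, 1, 1, 0], by simp, ?_⟩
          rw [gramClass_antidiag hσ one_ne_zero (Or.inr rfl)]
          simp [h4]; norm_num
        · obtain ⟨c, hc⟩ := hσ.exists_norm_eq w hfix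
          have hc0 : c ≠ 0 := by rintro rfl; simp at hc; exact hw0 hc.symm
          refine ⟨![0, 1, c, 0], by simp, ?_⟩
          rw [gramClass_antidiag hσ hc0 (Or.inl (by rwa [hc])), hc]
          congr 1
          field_simp
          linear_combination hq
      · have hq' := congrArg σ hq
        simp [ha, map_ofNat] at hq'
        have h : (σ w - w) * (w * σ w - 1) = 0 := by linear_combination w * hq' - σ w * hq
        have h : w * σ w = 1 :=
          sub_eq_zero.1 ((mul_eq_zero.1 h).resolve_left (sub_ne_zero.2 hfix))
        obtain ⟨s, hs0, hs⟩ := exists_conj_eq_mul hσ h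
        have hs1 : σ s ≠ s := by
          intro h'
          rw [hs, mul_eq_right₀ hs0] at h'
          simp [h'] at hfix
        have hs2 : σ s ≠ -s := by
          intro h'
          have : (w + 1) * s = 0 := by linear_combination h' - hs
          have : w = -1 := eq_neg_of_add_eq_zero_left ((mul_eq_zero.1 this).resolve_right hs0)
          simp [this] at hfix
        refine ⟨![1, 0, 0, s], by simp, ?_⟩
        rw [gramClass_diag hσ hs1, if_neg hs2, hs]
        congr 1
        field_simp
        linear_combination hq
    · fin_cases i
      · exact ⟨![0, 0, 0, 1], by simp, gramClass_point⟩
      · exact ⟨![0, 1, 0, 0], by simp, gramClass_rankOne⟩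
      · exact ⟨![1, 0, 0, t], by simp, by rw [gramClass_diag hσ ht', if_pos ht]; rfl⟩
      · exact ⟨![0, 1, 1, t], by simp, gramClass_skew hσ ht0 ht⟩

end NormalForms

/-! ### The Frobenius involution of `𝔽_{q²}` -/

section FiniteField

variable {F : Type*} [Field F] [Fintype F] {p n q : ℕ} {ξ : F}

lemma isPrimitiveRoot_of_generator (hF : Fintype.card F = q ^ 2) (hq : 3 ≤ q)
    (hξ : ∀ x : F, x ≠ 0 → ∃ m : ℕ, x = ξ ^ m) : IsPrimitiveRoot ξ (q ^ 2 - 1) := by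
  have hξ0 : ξ ≠ 0 := by
    rintro rfl
    have hle : Fintype.card F ≤ 2 := by
      classical
      rw [← Finset.card_univ]
      refine (Finset.card_le_card (t := {0, 1}) fun x _ => ?_).trans Finset.card_le_two
      by_cases hx : x = 0
      · simp [hx]
      · obtain ⟨m, rfl⟩ := hξ x hx
        rcases m with _ | m <;> simp
    nlinarith
  have hord : orderOf (Units.mk0 ξ hξ0) = q ^ 2 - 1 := by
    rw [orderOf_eq_card_of_forall_mem_zpowers, Nat.card_units, Nat.card_eq_fintype_card, hF]
    intro x
    obtain ⟨m, hm⟩ := hξ x x.ne_zero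
    exact ⟨m, by ext; simp [hm]⟩
  rw [← hord, ← orderOf_units]
  exact IsPrimitiveRoot.orderOf ξ

lemma charP_of_card (hp : p.Prime) (hq : q = p ^ n)
    (hF : Fintype.card F = q ^ 2) : CharP F p := by
  obtain ⟨r, hr⟩ := CharP.exists F
  obtain ⟨m, hr', hm⟩ := FiniteField.card F r
  have hdvd : r ∣ p := by
    have : r ∣ p ^ (n * 2) := by
      rw [pow_mul, ← hq, ← hF, hm]
      exact dvd_pow_self _ m.ne_zero
    exact hr'.dvd_of_dvd_pow this
  rwa [← (Nat.prime_dvd_prime_iff_eq hr' hp).1 hdvd]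

lemma exists_isFiniteConj (hp : p.Prime) (hodd : Odd p) (hq : q = p ^ n)
    (hF : Fintype.card F = q ^ 2) (hq3 : 3 ≤ q) (hξ : ∀ x : F, x ≠ 0 → ∃ m : ℕ, x = ξ ^ m) :
    ∃ σ : F →+* F, (∀ x, σ x = x ^ q) ∧ IsFiniteConj σ := by
  have hchar := charP_of_card hp hq hF
  have : Fact p.Prime := ⟨hp⟩
  have hprim := isPrimitiveRoot_of_generator hF hq3 hξ
  have hqodd : Odd q := hq ▸ hodd.pow
  obtain ⟨r, hr⟩ := hqodd
  have hr0 : 0 < r := by omega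
  have hsub : q ^ 2 - 1 = 2 * (r + 1) * (2 * r) := by
    rw [hr]
    have : (2 * r + 1) ^ 2 = 2 * (r + 1) * (2 * r) + 1 := by ring
    omega
  have hσ : ∀ x : F, iterateFrobenius F p n x = x ^ q := fun x => by
    rw [iterateFrobenius_def, hq]
  have hnorm : ∀ y : F, y ^ q = y → ∃ x, x * x ^ q = y := by
    intro y hy
    by_cases hy0 : y = 0
    · exact ⟨0, by simp [hy0]⟩
    obtain ⟨m, rfl⟩ := hξ y hy0
    have h1 : (ξ ^ m) ^ (2 * r) = 1 := by
      rw [hr, pow_succ] at hy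
      exact mul_eq_right₀ hy0 |>.1 hy
    rw [← pow_mul, hprim.pow_eq_one_iff_dvd, hsub,
      Nat.mul_dvd_mul_iff_right (by omega)] at h1
    obtain ⟨l, rfl⟩ := h1
    refine ⟨ξ ^ l, ?_⟩
    rw [← pow_succ', ← pow_mul, hr]
    ring
  refine ⟨iterateFrobenius F p n, hσ, ⟨fun x => ?_, ?_, ?_, ?_, ?_⟩⟩
  · rw [hσ, hσ, ← pow_mul, ← sq, ← hF, FiniteField.pow_card]
  · intro h2
    have : (p : ℕ) ∣ 2 := (CharP.cast_eq_zero_iff F p 2).1 (by exact_mod_cast h2)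
    have := (Nat.prime_dvd_prime_iff_eq hp Nat.prime_two).1 this
    subst this
    exact absurd hodd (by decide)
  · simpa only [hσ] using hnorm
  · intro y hy
    obtain ⟨x, hx⟩ := hnorm y (by rwa [← hσ])
    refine ⟨x ^ (r + 1), ?_⟩
    rw [← hx, ← pow_succ', hr]
    ring
  · have hξ0 : ξ ≠ 0 := hprim.ne_zero (by rw [hsub]; positivity)
    refine ⟨ξ ^ (r + 1), pow_ne_zero _ hξ0, ?_⟩
    have h1 : (ξ ^ ((r + 1) * (2 * r))) ^ 2 = 1 := by
      rw [← pow_mul, hprim.pow_eq_one_iff_dvd, hsub]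
      exact ⟨1, by ring⟩
    have h2 : ξ ^ ((r + 1) * (2 * r)) ≠ 1 := by
      rw [ne_eq, hprim.pow_eq_one_iff_dvd, hsub]
      intro h
      have := Nat.le_of_dvd (by positivity) h
      nlinarith
    have h3 := (mul_self_eq_one_iff.1 (by rw [← sq, h1])).resolve_left h2
    rw [hσ, hr, ← pow_mul, mul_add, pow_add, h3]
    ring

lemma ncard_fixed (hF : Fintype.card F = q ^ 2) (hq3 : 3 ≤ q)
    (hξ : ∀ x : F, x ≠ 0 → ∃ m : ℕ, x = ξ ^ m) : {a : F | a ^ q = a}.ncard = q := by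
  classical
  have hprim := isPrimitiveRoot_of_generator hF hq3 hξ
  obtain ⟨s, rfl⟩ : ∃ s, q = s + 1 := ⟨q - 1, by omega⟩
  have hsub : (s + 1) ^ 2 - 1 = (s + 2) * s := by
    have : (s + 1) ^ 2 = (s + 2) * s + 1 := by ring
    omega
  have hp' : IsPrimitiveRoot (ξ ^ (s + 2)) s :=
    hprim.pow (by rw [hsub]; exact Nat.mul_pos (by omega) (by omega)) hsub
  have heq : {a : F | a ^ (s + 1) = a} = ↑(insert 0 (Polynomial.nthRootsFinset s (1 : F))) := by
    ext a
    simp only [Set.mem_ofPred_eq, Finset.coe_insert, Set.mem_insert_iff, Finset.mem_coe,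
      Polynomial.mem_nthRootsFinset (show 0 < s by omega)]
    rw [pow_succ, mul_left_eq_self₀, or_comm]
  rw [heq, Set.ncard_coe_finset, Finset.card_insert_of_notMem, hp'.card_nthRootsFinset]
  rw [Polynomial.mem_nthRootsFinset (show 0 < s by omega), zero_pow (by omega)]
  exact zero_ne_one

end FiniteField

/-! ### Orbits of points -/

section Orbits

variable {F : Type*} [Field F] {σ : F →+* F} {q : ℕ}

lemma vecMul_kron (hσq : ∀ x, σ x = x ^ q) (A : Matrix (Fin 2) (Fin 2) F) (x : Fin 4 → F) :
    Matrix.vecMul x (kron (matq q A) A) =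
      twist σ ![A 0 0, A 1 0] ![A 0 1, A 1 1] x := by
  funext i
  fin_cases i <;>
    simp [Matrix.vecMul, dotProduct, Fin.sum_univ_four, kron, matq, twist, sesq, hσq] <;> ring

lemma gramEquiv_mk_rep (x : Fin 4 → F) (hx : x ≠ 0) :
    GramEquiv σ x (Projectivization.mk F x hx).rep := by
  obtain ⟨a, ha⟩ := Projectivization.exists_smul_eq_mk_rep F x hx
  rw [← ha]
  exact gramEquiv_smul x a.ne_zero

lemma mem_Gorb (hσq : ∀ x, σ x = x ^ q) {P Q : PGPoint F} :
    Q ∈ Gorb q P ↔ GramEquiv σ P.rep Q.rep := by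
  constructor
  · rintro ⟨A, hA, v, hv, hw, rfl, rfl⟩
    refine (gramEquiv_mk_rep v hv).symm.trans (GramEquiv.trans ?_ (gramEquiv_mk_rep _ hw))
    rw [vecMul_kron hσq]
    refine gramEquiv_twist v ?_
    rw [Matrix.det_fin_two] at hA
    convert hA using 1
    simp [wedge]; ring
  · rintro ⟨u, v, huv, m, hm, h⟩
    have hA : Matrix.vecMul P.rep (kron (matq q !![u 0, v 0; u 1, v 1]) !![u 0, v 0; u 1, v 1]) =
        twist σ u v P.rep := by
      rw [vecMul_kron hσq]
      congr 1 <;> funext i <;> fin_cases i <;> rfl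
    have hne : twist σ u v P.rep ≠ 0 := by
      intro h0
      exact Q.rep_nonzero (by rw [h, h0, smul_zero])
    refine ⟨!![u 0, v 0; u 1, v 1], ?_, P.rep, P.rep_nonzero, by rwa [hA], P.mk_rep.symm, ?_⟩
    · rw [Matrix.det_fin_two_of]
      convert huv using 1
      simp [wedge]; ring
    · simp only [hA]
      rw [← Q.mk_rep, Projectivization.mk_eq_mk_iff']
      exact ⟨m, h.symm⟩

lemma Gorb_eq_iff (hσ : IsFiniteConj σ) (hσq : ∀ x, σ x = x ^ q) {P Q : PGPoint F} :
    Gorb q P = Gorb q Q ↔ gramClass σ P.rep = gramClass σ Q.rep := by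
  constructor
  · intro h
    have : Q ∈ Gorb q P := by rw [h, mem_Gorb hσq]; exact GramEquiv.refl _
    exact gramClass_congr hσ ((mem_Gorb hσq).1 this)
  · intro h
    have h := gramEquiv_of_gramClass_eq hσ P.rep_nonzero Q.rep_nonzero h
    ext R
    rw [mem_Gorb hσq, mem_Gorb hσq]
    exact ⟨fun h' => h.symm.trans h', fun h' => h.trans h'⟩

lemma ncard_Gorb [Finite F] (hσ : IsFiniteConj σ) (hσq : ∀ x, σ x = x ^ q)
    (hfix : {a : F | a ^ q = a}.ncard = q) :
    {S : Set (PGPoint F) | ∃ P : PGPoint F, S = Gorb q P}.ncard = q + 4 := by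
  have hrange : Set.range (fun P : PGPoint F => gramClass σ P.rep) =
      gramClass σ '' {x | x ≠ 0} := by
    ext c
    constructor
    · rintro ⟨P, rfl⟩
      exact ⟨P.rep, P.rep_nonzero, rfl⟩
    · rintro ⟨x, hx, rfl⟩
      exact ⟨Projectivization.mk F x hx, (gramClass_congr hσ (gramEquiv_mk_rep x hx)).symm⟩
  have hcard : (gramClass σ '' {x | x ≠ 0}).ncard = q + 4 := by
    rw [range_gramClass hσ, Set.ncard_union_eq, Set.ncard_image_of_injective _ Sum.inl_injective,
      ← Set.image_univ, Set.ncard_image_of_injective _ Sum.inr_injective]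
    · simp [hσq, hfix]
    · rw [Set.disjoint_left]
      rintro _ ⟨a, -, rfl⟩ ⟨i, hi⟩
      cases hi
  rw [← hcard, ← hrange]
  refine (Set.ncard_congr (fun S hS => gramClass σ (Classical.choose hS).rep)
    (fun S hS => ⟨_, rfl⟩) (fun S T hS hT h => ?_) ?_)
  · rw [Classical.choose_spec hS, Classical.choose_spec hT]
    exact (Gorb_eq_iff hσ hσq).2 h
  · rintro _ ⟨P, rfl⟩
    have hP : ∃ Q : PGPoint F, Gorb q P = Gorb q Q := ⟨P, rfl⟩
    exact ⟨Gorb q P, hP, ((Gorb_eq_iff hσ hσq).1 (Classical.choose_spec hP)).symm⟩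

end Orbits

/-! ### Lines contained in a union of two zero loci -/

/-- Representatives of the points of the Hermitian Veronese curve. -/
def veronese {F : Type*} [Field F] (σ : F →+* F) : Option F → Fin 4 → F
  | none => ![0, 0, 0, 1]
  | some t => ![1, t, σ t, t * σ t]

/-- The planes of `F⁴` on which one of the forms `F_γ`, `F_δ` vanishes at every vector. -/
def lineSpaces {F : Type*} [Field F] (q : ℕ) (γ δ : F) : Set (Submodule F (Fin 4 → F)) :=
  {W | Module.finrank F W = 2 ∧ ∀ v ∈ W, Fgam q γ v = 0 ∨ Fgam q δ v = 0}

/-- The parameters `c` for which the line through `(0,0,0,1)` and `(0,1,c,0)` lies in `C_γ`. -/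
def tangentRoots {F : Type*} [Field F] (q : ℕ) (γ : F) : Set F :=
  {c | 1 + c * c ^ q + γ * (-c) ^ ((q + 1) / 2) = 0}

/-- An elliptic parameter `γ` together with a hyperbolic parameter `δ`. -/
structure IsParamPair {F : Type*} [Field F] (σ : F →+* F) (q : ℕ) (γ δ : F) : Prop where
  conj : IsFiniteConj σ
  conj_eq : ∀ x, σ x = x ^ q
  odd : Odd q
  left_ne_zero : γ ≠ 0
  right_ne_zero : δ ≠ 0
  left_ne_two : γ ≠ 2
  right_ne_two : δ ≠ 2
  left_roots : tangentRoots q γ = ∅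
  right_roots : (tangentRoots q δ).ncard = q + 1
  norm_ne_one : ∀ c ∈ tangentRoots q δ, c * σ c ≠ 1
  isIsotropic : ∀ x, Fgam q δ x = 0 → gramDet x ≠ 0 → IsIsotropic σ x

section Planes

variable {K V : Type*} [Field K] [AddCommGroup V] [Module K V]

lemma finrank_span_pair_eq_two {x y : V} (h : ∀ a b : K, a • x + b • y = 0 → a = 0 ∧ b = 0) :
    Module.finrank K (Submodule.span K {x, y}) = 2 := by
  have hl : LinearIndependent K ![x, y] := LinearIndependent.pair_iff.2 h
  have := finrank_span_eq_card hl
  rwa [Matrix.range_cons_cons_empty, Fintype.card_fin] at this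

lemma eq_span_pair [FiniteDimensional K V] {W : Submodule K V} (hW : Module.finrank K W = 2)
    {x y : V} (hx : x ∈ W) (hy : y ∈ W) (h : ∀ a b : K, a • x + b • y = 0 → a = 0 ∧ b = 0) :
    W = Submodule.span K {x, y} := by
  symm
  refine Submodule.eq_of_le_of_finrank_eq ?_ (by rw [finrank_span_pair_eq_two h, hW])
  rw [Submodule.span_le]
  rintro z (rfl | rfl) <;> assumption

lemma exists_notMem_span_singleton [FiniteDimensional K V] {W : Submodule K V}
    (hW : Module.finrank K W = 2) (x : V) : ∃ y ∈ W, y ∉ Submodule.span K {x} := by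
  by_contra! h
  have h1 := Submodule.finrank_mono (show W ≤ Submodule.span K {x} from h)
  have h2 := finrank_span_le_card (R := K) ({x} : Set V)
  simp at h2
  omega

end Planes

section Lines

variable {F : Type*} [Field F] {σ : F →+* F} {q : ℕ} {γ δ : F}

/-- A Hermitian form on a plane has a nonzero isotropic vector. -/
lemma exists_herm_eq_zero (hσ : IsFiniteConj σ) {W : Submodule F (Fin 4 → F)}
    (hW : Module.finrank F W = 2) : ∃ v ∈ W, v ≠ 0 ∧ herm σ v = 0 := by
  obtain ⟨v, hv, hv0⟩ := exists_notMem_span_singleton hW 0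
  have hv0 : v ≠ 0 := by simpa using hv0
  by_cases h0 : herm σ v = 0
  · exact ⟨v, hv, hv0, h0⟩
  obtain ⟨w, hw, hwv⟩ := exists_notMem_span_singleton hW v
  let polar : (Fin 4 → F) → F := fun z =>
    σ (v 0) * z 3 + σ (v 3) * z 0 - σ (v 1) * z 1 - σ (v 2) * z 2
  have hexp : ∀ (a : F) (z : Fin 4 → F), herm σ (a • v + z) =
      a * σ a * herm σ v + herm σ z + (σ a * polar z + σ (σ a * polar z)) := by
    intro a z
    simp [herm, polar, hσ.invol]
    ring
  obtain ⟨z, hz⟩ : ∃ z, z = w - (polar w / herm σ v) • v := ⟨_, rfl⟩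
  have hpz : polar z = 0 := by
    have : polar z = polar w - polar w / herm σ v * herm σ v := by
      rw [hz]; simp [polar, herm]; ring
    rw [this]
    field_simp
    ring
  obtain ⟨a, ha⟩ := hσ.exists_norm_eq (-herm σ z / herm σ v) (by
    rw [map_div₀, map_neg, conj_herm hσ, conj_herm hσ])
  refine ⟨a • v + z, ?_, fun h => hwv ?_, ?_⟩
  · rw [hz]
    exact W.add_mem (W.smul_mem _ hv) (W.sub_mem hw (W.smul_mem _ hv))
  · rw [Submodule.mem_span_singleton]
    refine ⟨polar w / herm σ v - a, ?_⟩
    rw [hz] at h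
    rw [sub_smul, ← sub_eq_zero, ← neg_eq_zero, ← h]
    abel
  · rw [hexp, hpz, ha]
    field_simp
    simp

lemma conj_rel {a b : F} (hσ : IsFiniteConj σ)
    (h : a * b + σ a * σ b - a * σ a - b * σ b = 0) : b = σ a := by
  have : (a - σ b) * (b - σ a) = 0 := by linear_combination h
  rcases mul_eq_zero.1 this with h | h
  · rw [sub_eq_zero.1 h, hσ.invol]
  · exact sub_eq_zero.1 h

lemma eq_smul_veronese (hσ : IsFiniteConj σ) {x : Fin 4 → F} (hx : x ≠ 0)
    (hd : gramDet x = 0) (hh : herm σ x = 0) : ∃ i, ∃ m : F, m ≠ 0 ∧ x = m • veronese σ i := by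
  by_cases h0 : x 0 = 0
  · have h12 : x 1 * x 2 = 0 := by simpa [gramDet, h0] using hd
    have hN : x 1 * σ (x 1) + x 2 * σ (x 2) = 0 := by
      simp [herm, h0] at hh; linear_combination -hh
    have h1 : x 1 = 0 := by
      rcases mul_eq_zero.1 h12 with h | h
      · exact h
      · simpa [h] using hN
    have h2 : x 2 = 0 := by simpa [h1] using hN
    refine ⟨none, x 3, fun h3 => hx ?_, ?_⟩ <;> funext i <;> fin_cases i <;>
      simp [veronese, *]
  · obtain ⟨y, hy⟩ : ∃ y, y = (x 0)⁻¹ • x := ⟨_, rfl⟩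
    have hy0 : y 0 = 1 := by simp [hy, h0]
    have hd' : y 3 = y 1 * y 2 := by
      have : gramDet y = 0 := by rw [hy, gramDet_smul, hd, mul_zero]
      rw [gramDet, hy0] at this
      linear_combination this
    have h2 : y 2 = σ (y 1) := by
      apply conj_rel hσ
      have : herm σ y = 0 := by rw [hy, herm_smul, hh, mul_zero]
      rw [herm, hy0, hd'] at this
      simp at this
      linear_combination this
    refine ⟨some (y 1), x 0, h0, ?_⟩
    have hxy : x = x 0 • y := by rw [hy, smul_smul, mul_inv_cancel₀ h0, one_smul]
    have hyv : y = veronese σ (some (y 1)) := by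
      funext i
      fin_cases i
      · exact hy0
      · rfl
      · exact h2
      · show y 3 = y 1 * σ (y 1)
        rw [hd', h2]
    rw [← hyv]
    exact hxy

lemma veronese_ne_zero (i : Option F) : veronese σ i ≠ 0 := by
  rcases i with _ | t <;> simp [veronese]

lemma gramDet_veronese (i : Option F) : gramDet (veronese σ i) = 0 := by
  rcases i with _ | t <;> simp [veronese, gramDet]

lemma veronese_injective {i k : Option F} {m : F} (h : veronese σ i = m • veronese σ k) :
    i = k := by
  have h0 := congrFun h 0
  have h1 := congrFun h 1
  have h3 := congrFun h 3
  rcases i with _ | s <;> rcases k with _ | t <;> simp [veronese] at h0 h1 h3 ⊢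
  · simp [← h0] at h3
  · rw [h1, ← h0, one_mul]

/-- The curve is an orbit of the unimodular group. -/
lemma exists_twist_veronese (i : Option F) :
    ∃ u v : Fin 2 → F, wedge u v = 1 ∧ twist σ u v (veronese σ i) = veronese σ none ∧
      ∀ t, i = some t → u = ![-t, 1] := by
  rcases i with _ | t
  · refine ⟨![1, 0], ![0, 1], by simp [wedge], ?_, by simp⟩
    funext i; fin_cases i <;> simp [twist, sesq, veronese]
  · refine ⟨![-t, 1], ![-1, 0], by simp [wedge], ?_, by simp⟩
    funext i; fin_cases i <;> simp [twist, sesq, veronese]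

/-- A unimodular change of basis, acting on Gram matrices. -/
def twistEquiv (σ : F →+* F) (u v : Fin 2 → F) (h : wedge u v = 1) :
    (Fin 4 → F) ≃ₗ[F] (Fin 4 → F) where
  toFun := twist σ u v
  invFun := twist σ ![v 1, -u 1] ![-v 0, u 0]
  map_add' := twist_add u v
  map_smul' := twist_smul u v
  left_inv x := by rw [twist_adjugate, h, map_one, one_mul, one_smul]
  right_inv x := by rw [twist_adjugate', h, map_one, one_mul, one_smul]

namespace IsParamPair

lemma Fgam_eq (H : IsParamPair σ q γ δ) (ε : F) (x : Fin 4 → F) :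
    Fgam q ε x = herm σ x - ε * gramDet x ^ ((q + 1) / 2) := by
  simp only [Fgam, herm, gramDet, H.conj_eq]
  ring

lemma two_mul_half (H : IsParamPair σ q γ δ) : 2 * ((q + 1) / 2) = q + 1 := by
  obtain ⟨r, hr⟩ := H.odd
  omega

lemma half_ne_zero (H : IsParamPair σ q γ δ) : (q + 1) / 2 ≠ 0 := by
  have := H.two_mul_half
  omega

lemma Fgam_smul (H : IsParamPair σ q γ δ) (ε a : F) (x : Fin 4 → F) :
    Fgam q ε (a • x) = a * σ a * Fgam q ε x := by
  rw [H.Fgam_eq, H.Fgam_eq, herm_smul, gramDet_smul, mul_pow, ← pow_mul, H.two_mul_half,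
    H.conj_eq]
  ring

lemma Fgam_smul_eq_zero (H : IsParamPair σ q γ δ) (ε : F) {a : F} (ha : a ≠ 0)
    (x : Fin 4 → F) : Fgam q ε (a • x) = 0 ↔ Fgam q ε x = 0 := by
  simp [H.Fgam_smul, ha]

lemma Fgam_twist (H : IsParamPair σ q γ δ) (ε : F) {u v : Fin 2 → F} (h : wedge u v = 1)
    (x : Fin 4 → F) : Fgam q ε (twist σ u v x) = Fgam q ε x := by
  rw [H.Fgam_eq, H.Fgam_eq, herm_twist H.conj, gramDet_twist, h]
  simp

lemma Fgam_tangent (H : IsParamPair σ q γ δ) (ε c : F) :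
    Fgam q ε ![0, 1, c, 0] = 0 ↔ c ∈ tangentRoots q ε := by
  rw [H.Fgam_eq, ← neg_eq_zero]
  simp [herm, gramDet, tangentRoots, H.conj_eq]
  constructor <;> intro h <;> linear_combination h

/-- `S_γ` and `E_δ` meet in the Hermitian Veronese curve only. -/
lemma gramDet_eq_zero (H : IsParamPair σ q γ δ) {x : Fin 4 → F} (h : Fgam q γ x = 0)
    (h' : Fgam q δ x = 0) : gramDet x = 0 := by
  rw [H.Fgam_eq] at h h'
  have hne : γ - δ ≠ 0 := by
    refine sub_ne_zero.2 fun e => ?_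
    have := H.right_roots
    rw [← e, H.left_roots] at this
    simp at this
  have : (γ - δ) * gramDet x ^ ((q + 1) / 2) = 0 := by linear_combination h' - h
  simpa [hne, H.half_ne_zero] using this

/-- Unimodular maps permute the planes under consideration. -/
lemma map_mem_lineSpaces (H : IsParamPair σ q γ δ) {u v : Fin 2 → F} (h : wedge u v = 1)
    {W : Submodule F (Fin 4 → F)} :
    W.map (twistEquiv σ u v h : (Fin 4 → F) →ₗ[F] (Fin 4 → F)) ∈ lineSpaces q γ δ ↔
      W ∈ lineSpaces q γ δ := by
  have h1 : Module.finrank F (W.map (twistEquiv σ u v h : (Fin 4 → F) →ₗ[F] (Fin 4 → F))) =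
      Module.finrank F W := LinearEquiv.finrank_map_eq _ _
  have h2 : ∀ ε x, Fgam q ε (twistEquiv σ u v h x) = Fgam q ε x :=
    fun ε x => H.Fgam_twist ε h x
  simp only [lineSpaces, Set.mem_ofPred_eq, h1]
  refine and_congr_right fun _ => ⟨fun h3 x hx => ?_, ?_⟩
  · simpa [h2] using h3 _ (Submodule.mem_map_of_mem hx)
  · rintro h3 _ ⟨x, hx, rfl⟩
    simpa [h2] using h3 x hx

lemma apply_zero_eq_zero (H : IsParamPair σ q γ δ) {W : Submodule F (Fin 4 → F)}
    (hW : W ∈ lineSpaces q γ δ) (hinf : veronese σ none ∈ W) {x : Fin 4 → F} (hx : x ∈ W) :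
    x 0 = 0 := by
  by_contra h0
  have key : ∀ s, ![1, x 1 / x 0, x 2 / x 0, s] ∈ W := by
    intro s
    have : (![1, x 1 / x 0, x 2 / x 0, s] : Fin 4 → F) =
        (x 0)⁻¹ • x + (s - x 3 / x 0) • veronese σ none := by
      funext i
      fin_cases i <;> simp [veronese, h0, div_eq_inv_mul]
    rw [this]
    exact W.add_mem (W.smul_mem _ hx) (W.smul_mem _ hinf)
  generalize x 1 / x 0 = a at key
  generalize x 2 / x 0 = b at key
  have hb : b = σ a := by
    apply conj_rel H.conj
    have hd : gramDet ![1, a, b, a * b] = 0 := by simp [gramDet]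
    have h := hW.2 _ (key (a * b))
    rw [H.Fgam_eq, H.Fgam_eq, hd, zero_pow H.half_ne_zero, mul_zero, mul_zero, or_self,
      sub_zero] at h
    simp [herm] at h
    linear_combination h
  have hd : gramDet ![1, a, b, a * b + 1] = 1 := by simp [gramDet]
  have hh : herm σ ![1, a, b, a * b + 1] = 2 := by
    simp [herm, hb, H.conj.invol]
    ring
  have h := hW.2 _ (key (a * b + 1))
  rw [H.Fgam_eq, H.Fgam_eq, hd, hh, one_pow, mul_one, mul_one, sub_eq_zero, sub_eq_zero] at h
  exact h.elim (fun h => H.left_ne_two h.symm) (fun h => H.right_ne_two h.symm)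

lemma tangent_independent (c a b : F) (h : a • veronese σ none + b • ![0, 1, c, 0] = 0) :
    a = 0 ∧ b = 0 := by
  have h1 := congrFun h 1
  have h3 := congrFun h 3
  simp [veronese] at h1 h3
  exact ⟨h3, h1⟩

lemma Fgam_eq_zero_of_mem_span (H : IsParamPair σ q γ δ) {c : F} (hc : c ∈ tangentRoots q δ)
    {x : Fin 4 → F} (hx : x ∈ Submodule.span F {veronese σ none, ![0, 1, c, 0]}) :
    Fgam q δ x = 0 := by
  obtain ⟨a, b, rfl⟩ := Submodule.mem_span_pair.1 hx
  have h1 : Fgam q δ (b • ![0, 1, c, 0]) = 0 := by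
    rw [H.Fgam_smul, (H.Fgam_tangent δ c).2 hc, mul_zero]
  refine Eq.trans ?_ h1
  rw [H.Fgam_eq, H.Fgam_eq]
  simp [herm, gramDet, veronese]

lemma span_mem_lineSpaces (H : IsParamPair σ q γ δ) {c : F} (hc : c ∈ tangentRoots q δ) :
    Submodule.span F {veronese σ none, ![0, 1, c, 0]} ∈ lineSpaces q γ δ :=
  ⟨finrank_span_pair_eq_two (tangent_independent c),
    fun _ hx => Or.inr (H.Fgam_eq_zero_of_mem_span hc hx)⟩

lemma exists_eq_span (H : IsParamPair σ q γ δ) {W : Submodule F (Fin 4 → F)}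
    (hW : W ∈ lineSpaces q γ δ) (hinf : veronese σ none ∈ W) :
    ∃ c ∈ tangentRoots q δ, W = Submodule.span F {veronese σ none, ![0, 1, c, 0]} := by
  obtain ⟨x, hx, hxn⟩ := exists_notMem_span_singleton hW.1 (veronese σ none)
  have hx0 := H.apply_zero_eq_zero hW hinf hx
  have hx1 : x 1 ≠ 0 := by
    intro hx1
    have hx2 : x 2 ≠ 0 := by
      intro hx2
      refine hxn (Submodule.mem_span_singleton.2 ⟨x 3, ?_⟩)
      funext i
      fin_cases i <;> simp [veronese, *]
    have h := hW.2 x hx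
    simp [H.Fgam_eq, herm, gramDet, hx0, hx1, hx2, H.half_ne_zero] at h
  have hc : ![0, 1, x 2 / x 1, 0] ∈ W := by
    have : (![0, 1, x 2 / x 1, 0] : Fin 4 → F) =
        (x 1)⁻¹ • x + (-(x 3 / x 1)) • veronese σ none := by
      funext i
      fin_cases i <;> simp [veronese, hx0, hx1, div_eq_inv_mul]
    rw [this]
    exact W.add_mem (W.smul_mem _ hx) (W.smul_mem _ hinf)
  refine ⟨x 2 / x 1, ?_, eq_span_pair hW.1 hinf hc (tangent_independent _)⟩
  have h := hW.2 _ hc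
  rw [H.Fgam_tangent, H.Fgam_tangent, H.left_roots] at h
  exact h.resolve_left (Set.notMem_empty _)

lemma mem_span_tangent {c d : F} :
    ![0, 1, d, 0] ∈ Submodule.span F {veronese σ none, ![0, 1, c, 0]} ↔ d = c := by
  refine ⟨fun h => ?_, fun h => h ▸ Submodule.subset_span (by simp)⟩
  obtain ⟨a, b, h⟩ := Submodule.mem_span_pair.1 h
  have h1 := congrFun h 1
  have h2 := congrFun h 2
  simp [veronese] at h1 h2
  rw [← h2, h1, one_mul]

lemma ncard_through_infinity (H : IsParamPair σ q γ δ) :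
    {W | W ∈ lineSpaces q γ δ ∧ veronese σ none ∈ W}.ncard = q + 1 := by
  rw [← H.right_roots]
  symm
  refine Set.ncard_congr
    (fun c _ => Submodule.span F {veronese σ none, ![0, 1, c, 0]}) ?_ ?_ ?_
  · exact fun c hc => ⟨H.span_mem_lineSpaces hc, Submodule.subset_span (by simp)⟩
  · intro c d hc hd h
    have h : Submodule.span F {veronese σ none, ![0, 1, c, 0]} =
      Submodule.span F {veronese σ none, ![0, 1, d, 0]} := h
    refine mem_span_tangent.1 (h ▸ mem_span_tangent.2 rfl)
  · rintro W ⟨hW, hinf⟩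
    obtain ⟨c, hc, h⟩ := H.exists_eq_span hW hinf
    exact ⟨c, hc, h.symm⟩

/-- The number of planes through a vector is invariant under unimodular maps. -/
lemma ncard_through_twist (H : IsParamPair σ q γ δ) {u v : Fin 2 → F} (h : wedge u v = 1)
    (x : Fin 4 → F) : {W | W ∈ lineSpaces q γ δ ∧ x ∈ W}.ncard =
      {W | W ∈ lineSpaces q γ δ ∧ twist σ u v x ∈ W}.ncard := by
  refine Set.ncard_congr
    (fun W _ => W.map (twistEquiv σ u v h : (Fin 4 → F) →ₗ[F] (Fin 4 → F))) ?_ ?_ ?_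
  · exact fun W hW => ⟨(H.map_mem_lineSpaces h).2 hW.1, Submodule.mem_map_of_mem hW.2⟩
  · intro W W' _ _ hWW
    exact Submodule.map_injective_of_injective (twistEquiv σ u v h).injective hWW
  · rintro W ⟨hW, hx⟩
    have hmap : (W.map ((twistEquiv σ u v h).symm : (Fin 4 → F) →ₗ[F] (Fin 4 → F))).map
        (twistEquiv σ u v h : (Fin 4 → F) →ₗ[F] (Fin 4 → F)) = W := by
      rw [← Submodule.map_comp]
      simp
    refine ⟨_, ⟨(H.map_mem_lineSpaces h).1 (hmap.symm ▸ hW), ?_⟩, hmap⟩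
    exact ⟨_, hx, (twistEquiv σ u v h).symm_apply_apply x⟩

lemma ncard_through_smul {m : F} (hm : m ≠ 0) (x : Fin 4 → F) :
    {W | W ∈ lineSpaces q γ δ ∧ m • x ∈ W}.ncard =
      {W | W ∈ lineSpaces q γ δ ∧ x ∈ W}.ncard := by
  simp_rw [Submodule.smul_mem_iff _ hm]

lemma ncard_through_veronese (H : IsParamPair σ q γ δ) (i : Option F) :
    {W | W ∈ lineSpaces q γ δ ∧ veronese σ i ∈ W}.ncard = q + 1 := by
  obtain ⟨u, v, h, hi, -⟩ := exists_twist_veronese (σ := σ) i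
  rw [H.ncard_through_twist h, hi, H.ncard_through_infinity]

lemma exists_veronese_mem (H : IsParamPair σ q γ δ) {W : Submodule F (Fin 4 → F)}
    (hW : W ∈ lineSpaces q γ δ) : ∃ i, veronese σ i ∈ W := by
  obtain ⟨v, hv, hv0, hh⟩ := exists_herm_eq_zero H.conj hW.1
  have h := hW.2 v hv
  simp [H.Fgam_eq, hh, H.left_ne_zero, H.right_ne_zero, H.half_ne_zero] at h
  obtain ⟨i, m, hm, rfl⟩ := eq_smul_veronese H.conj hv0 h hh
  exact ⟨i, (W.smul_mem_iff hm).1 hv⟩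

/-- Every plane under consideration is, up to a unimodular map, a plane through infinity. -/
lemma map_eq_span (H : IsParamPair σ q γ δ) {W : Submodule F (Fin 4 → F)}
    (hW : W ∈ lineSpaces q γ δ) {i : Option F} (hi : veronese σ i ∈ W) {u v : Fin 2 → F}
    (h : wedge u v = 1) (hu : twist σ u v (veronese σ i) = veronese σ none) :
    ∃ c ∈ tangentRoots q δ, ∀ x ∈ W,
      twist σ u v x ∈ Submodule.span F {veronese σ none, ![0, 1, c, 0]} := by
  have hinf : veronese σ none ∈
      W.map (twistEquiv σ u v h : (Fin 4 → F) →ₗ[F] (Fin 4 → F)) := ⟨_, hi, hu⟩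
  obtain ⟨c, hc, hc'⟩ := H.exists_eq_span ((H.map_mem_lineSpaces h).2 hW) hinf
  refine ⟨c, hc, fun x hx => ?_⟩
  rw [← hc']
  exact ⟨x, hx, rfl⟩

lemma Fgam_eq_zero_of_mem (H : IsParamPair σ q γ δ) {W : Submodule F (Fin 4 → F)}
    (hW : W ∈ lineSpaces q γ δ) {x : Fin 4 → F} (hx : x ∈ W) : Fgam q δ x = 0 := by
  obtain ⟨i, hi⟩ := H.exists_veronese_mem hW
  obtain ⟨u, v, h, hu, -⟩ := exists_twist_veronese (σ := σ) i
  obtain ⟨c, hc, hW'⟩ := H.map_eq_span hW hi h hu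
  rw [← H.Fgam_twist δ h]
  exact H.Fgam_eq_zero_of_mem_span hc (hW' x hx)

lemma ne_zero_of_mem_roots (H : IsParamPair σ q γ δ) {c : F} (hc : c ∈ tangentRoots q δ) :
    c ≠ 0 := by
  rintro rfl
  simp [tangentRoots, H.half_ne_zero] at hc

lemma veronese_mem_unique (H : IsParamPair σ q γ δ) {W : Submodule F (Fin 4 → F)}
    (hW : W ∈ lineSpaces q γ δ) {i k : Option F} (hi : veronese σ i ∈ W)
    (hk : veronese σ k ∈ W) : k = i := by
  obtain ⟨u, v, h, hu, -⟩ := exists_twist_veronese (σ := σ) i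
  obtain ⟨c, hc, hW'⟩ := H.map_eq_span hW hi h hu
  obtain ⟨a, b, hab⟩ := Submodule.mem_span_pair.1 (hW' _ hk)
  have hd : gramDet (twist σ u v (veronese σ k)) = 0 := by
    rw [gramDet_twist, gramDet_veronese, mul_zero]
  rw [← hab] at hd
  have hb : b = 0 := by
    simpa [gramDet, veronese, H.ne_zero_of_mem_roots hc] using hd
  apply veronese_injective (σ := σ) (m := a)
  apply (twistEquiv σ u v h).injective
  rw [map_smul]
  show twist σ u v (veronese σ k) = a • twist σ u v (veronese σ i)
  rw [← hab, hb, hu, zero_smul, add_zero]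

lemma ncard_lineSpaces [Fintype F] (H : IsParamPair σ q γ δ) :
    (lineSpaces q γ δ).ncard = (q + 1) * (Fintype.card F + 1) := by
  have hU : lineSpaces q γ δ =
      ⋃ i : Option F, {W | W ∈ lineSpaces q γ δ ∧ veronese σ i ∈ W} := by
    ext W
    simp only [Set.mem_iUnion, Set.mem_ofPred_eq]
    exact ⟨fun h => (H.exists_veronese_mem h).imp fun i hi => ⟨h, hi⟩, fun ⟨_, h⟩ => h.1⟩
  have hfin : Finite (Submodule F (Fin 4 → F)) := inferInstance
  rw [hU, Set.ncard_iUnion_of_finite (fun _ => Set.toFinite _)]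
  · simp [finsum_eq_sum_of_fintype, H.ncard_through_veronese]
    ring
  · intro i k hik
    refine Set.disjoint_left.2 fun W hi hk => hik ?_
    exact H.veronese_mem_unique hk.1 hk.2 hi.2

/-- No plane passes through a vector of `C_γ` off the curve. -/
lemma notMem_of_left (H : IsParamPair σ q γ δ) {x : Fin 4 → F} (h : Fgam q γ x = 0)
    (hd : gramDet x ≠ 0) {W : Submodule F (Fin 4 → F)} (hW : W ∈ lineSpaces q γ δ) : x ∉ W :=
  fun hx => hd (H.gramDet_eq_zero h (H.Fgam_eq_zero_of_mem hW hx))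

/-- The line joining `(1,0,0,0)` to a tangent point `(0,1,c,0)` lies in `C_δ`. -/
lemma span_origin_mem_lineSpaces (H : IsParamPair σ q γ δ) {c : F}
    (hc : c ∈ tangentRoots q δ) :
    Submodule.span F {veronese σ (some 0), ![0, 1, c, 0]} ∈ lineSpaces q γ δ := by
  refine ⟨finrank_span_pair_eq_two fun a b h => ?_, fun x hx => Or.inr ?_⟩
  · have h0 := congrFun h 0
    have h1 := congrFun h 1
    simp [veronese] at h0 h1
    exact ⟨h0, h1⟩
  · obtain ⟨a, b, rfl⟩ := Submodule.mem_span_pair.1 hx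
    have h1 : Fgam q δ (b • ![0, 1, c, 0]) = 0 := by
      rw [H.Fgam_smul, (H.Fgam_tangent δ c).2 hc, mul_zero]
    refine Eq.trans ?_ h1
    rw [H.Fgam_eq, H.Fgam_eq]
    simp [herm, gramDet, veronese]

lemma eq_zero_of_mem (H : IsParamPair σ q γ δ) {c : F} (hc : c ∈ tangentRoots q δ)
    {W : Submodule F (Fin 4 → F)} (hW : W ∈ lineSpaces q γ δ) (hcW : ![0, 1, c, 0] ∈ W)
    {t : F} (ht : veronese σ (some t) ∈ W) : t = 0 := by
  obtain ⟨u, v, h, hu, ht'⟩ := exists_twist_veronese (σ := σ) (some t)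
  have h0 := H.apply_zero_eq_zero ((H.map_mem_lineSpaces h).2 hW) ⟨_, ht, hu⟩
    (Submodule.mem_map_of_mem hcW)
  have h0 : σ t + c * t = 0 := by
    simp [twistEquiv, twist, sesq, ht' t rfl] at h0
    linear_combination -h0
  have h1 : t + σ c * σ t = 0 := by
    have := congrArg σ h0
    simpa [H.conj.invol] using this
  have h2 : (1 - c * σ c) * t = 0 := by linear_combination h1 - σ c * h0
  exact (mul_eq_zero.1 h2).resolve_left
    (sub_ne_zero.2 (Ne.symm (H.norm_ne_one c hc)))

lemma ncard_through_tangent (H : IsParamPair σ q γ δ) {c : F} (hc : c ∈ tangentRoots q δ) :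
    {W | W ∈ lineSpaces q γ δ ∧ ![0, 1, c, 0] ∈ W}.ncard = 2 := by
  rw [Set.ncard_eq_two]
  refine ⟨Submodule.span F {veronese σ none, ![0, 1, c, 0]},
    Submodule.span F {veronese σ (some 0), ![0, 1, c, 0]}, fun h => ?_, ?_⟩
  · have h1 := H.apply_zero_eq_zero (H.span_mem_lineSpaces hc) (Submodule.subset_span (by simp))
      (x := veronese σ (some 0)) (by rw [h]; exact Submodule.subset_span (by simp))
    simp [veronese] at h1
  · ext W
    constructor
    · rintro ⟨hW, hcW⟩
      have hspan : ∀ i, veronese σ i ∈ W → ∀ W' ∈ lineSpaces q γ δ,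
          Submodule.span F {veronese σ i, ![0, 1, c, 0]} = W' → W = W' := by
        rintro i hi W' hW' rfl
        refine (Submodule.eq_of_le_of_finrank_eq ?_ (by rw [hW.1, hW'.1])).symm
        rw [Submodule.span_le]
        rintro z (rfl | rfl) <;> assumption
      obtain ⟨i, hi⟩ := H.exists_veronese_mem hW
      rcases i with _ | t
      · exact Or.inl (hspan _ hi _ (H.span_mem_lineSpaces hc) rfl)
      · obtain rfl := H.eq_zero_of_mem hc hW hcW hi
        exact Or.inr (hspan _ hi _ (H.span_origin_mem_lineSpaces hc) rfl)
    · rintro (rfl | rfl)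
      · exact ⟨H.span_mem_lineSpaces hc, Submodule.subset_span (by simp)⟩
      · exact ⟨H.span_origin_mem_lineSpaces hc, Submodule.subset_span (by simp)⟩

/-- A normal form for the vectors of `C_δ` off the curve. -/
lemma exists_twist_eq_tangent (H : IsParamPair σ q γ δ) {x : Fin 4 → F}
    (hx : Fgam q δ x = 0) (hd : gramDet x ≠ 0) : ∃ u v : Fin 2 → F, wedge u v = 1 ∧
      ∃ c ∈ tangentRoots q δ, ∃ m : F, m ≠ 0 ∧ twist σ u v x = m • ![0, 1, c, 0] := by
  obtain ⟨u, hu, hu0⟩ := H.isIsotropic x hx hd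
  obtain ⟨v, hv⟩ := exists_wedge_eq_one hu
  obtain ⟨y, hy⟩ : ∃ y, y = twist σ u v x := ⟨_, rfl⟩
  have hy0 : y 0 = 0 := by rw [hy]; exact hu0
  have hyd : gramDet y ≠ 0 := by rw [hy, gramDet_twist, hv]; simpa using hd
  have hyF : Fgam q δ y = 0 := by rw [hy, H.Fgam_twist δ hv, hx]
  have hy1 : y 1 ≠ 0 := fun h => hyd (by simp [gramDet, hy0, h])
  have h2 : y 1 * (y 2 / y 1) = y 2 := by field_simp
  have hform : ∀ a s : F, s = y 3 + (σ a + y 2 / y 1 * a) * y 1 →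
      twist σ u (a • u + v) x = ![0, y 1, y 1 * (y 2 / y 1), s] := by
    rintro a s rfl
    have h := twist_twist (σ := σ) u v ![1, 0] ![a, 1] x
    simp only [Matrix.cons_val_zero, Matrix.cons_val_one, one_smul, zero_smul, add_zero] at h
    rw [← h, ← hy, h2]
    funext i
    fin_cases i <;> simp [twist, sesq, hy0]
    linear_combination (-a) * h2
  have hwedge : ∀ a : F, wedge u (a • u + v) = 1 := by
    intro a
    rw [← hv]
    simp [wedge]
    ring
  have hroot : y 2 / y 1 ∈ tangentRoots q δ := by
    rw [← H.Fgam_tangent, ← H.Fgam_smul_eq_zero δ hy1]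
    refine Eq.trans ?_ hyF
    rw [H.Fgam_eq, H.Fgam_eq]
    simp [herm, gramDet, hy0, h2]
  obtain ⟨a, ha⟩ := exists_conj_shift H.conj (H.norm_ne_one _ hroot) (-y 3 / y 1)
  refine ⟨u, a • u + v, hwedge a, y 2 / y 1, hroot, y 1, hy1, ?_⟩
  rw [hform a 0 (by rw [ha]; field_simp; ring)]
  simp

/-- Exactly two planes pass through a vector of `C_δ` off the curve. -/
lemma ncard_through_right (H : IsParamPair σ q γ δ) {x : Fin 4 → F}
    (hx : Fgam q δ x = 0) (hd : gramDet x ≠ 0) :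
    {W | W ∈ lineSpaces q γ δ ∧ x ∈ W}.ncard = 2 := by
  obtain ⟨u, v, h, c, hc, m, hm, hxc⟩ := H.exists_twist_eq_tangent hx hd
  rw [H.ncard_through_twist h, hxc, ncard_through_smul hm, H.ncard_through_tangent hc]

end IsParamPair

end Lines

/-! ### Lines of the projective space -/

section Projective

variable {F : Type*} [Field F] {σ : F →+* F} {q : ℕ} {γ δ : F}

/-- The set of points of a subspace. -/
def pointSet (W : Submodule F (Fin 4 → F)) : Set (PGPoint F) := {P | P.rep ∈ W}

lemma mk_mem_pointSet {W : Submodule F (Fin 4 → F)} {x : Fin 4 → F} (hx : x ≠ 0) :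
    Projectivization.mk F x hx ∈ pointSet W ↔ x ∈ W := by
  obtain ⟨a, ha⟩ := Projectivization.exists_smul_eq_mk_rep F x hx
  rw [pointSet, Set.mem_ofPred_eq, ← ha]
  exact W.smul_mem_iff a.ne_zero

lemma pointSet_injective :
    Function.Injective (pointSet : Submodule F (Fin 4 → F) → Set (PGPoint F)) := by
  intro W W' h
  ext x
  rcases eq_or_ne x 0 with rfl | hx
  · simp
  · rw [← mk_mem_pointSet hx, h, mk_mem_pointSet hx]

lemma mem_Oset (hσq : ∀ x, σ x = x ^ q) {P : PGPoint F} :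
    P ∈ Oset F q ↔ ∃ i, ∃ m : F, m ≠ 0 ∧ P.rep = m • veronese σ i := by
  have hv : ∀ t : F, (![1, t, t ^ q, t ^ (q + 1)] : Fin 4 → F) = veronese σ (some t) := by
    intro t
    rw [veronese, hσq, pow_succ']
  have key : ∀ i, (∃ h, P = Projectivization.mk F (veronese σ i) h) ↔
      ∃ m : F, m ≠ 0 ∧ P.rep = m • veronese σ i := by
    intro i
    constructor
    · rintro ⟨h, rfl⟩
      obtain ⟨a, ha⟩ := Projectivization.exists_smul_eq_mk_rep F _ h
      exact ⟨a, a.ne_zero, ha.symm⟩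
    · rintro ⟨m, hm, h⟩
      refine ⟨veronese_ne_zero i, ?_⟩
      rw [← P.mk_rep, Projectivization.mk_eq_mk_iff']
      exact ⟨m, h.symm⟩
  simp only [Oset, Set.mem_ofPred_eq, hv, ← key]
  constructor
  · rintro (⟨t, h⟩ | h)
    exacts [⟨some t, h⟩, ⟨none, h⟩]
  · rintro ⟨_ | t, h⟩
    exacts [Or.inr h, Or.inl ⟨t, h⟩]

namespace IsParamPair

lemma mem_Cgam (H : IsParamPair σ q γ δ) {ε : F} {P : PGPoint F} :
    P ∈ Cgam q ε ↔ Fgam q ε P.rep = 0 := by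
  refine ⟨fun h => h _ P.rep_nonzero P.mk_rep.symm, ?_⟩
  rintro h v hv rfl
  obtain ⟨a, ha⟩ := Projectivization.exists_smul_eq_mk_rep F v hv
  rw [← ha] at h
  exact (H.Fgam_smul_eq_zero ε a.ne_zero v).1 h

lemma pointSet_subset (H : IsParamPair σ q γ δ) {W : Submodule F (Fin 4 → F)} :
    pointSet W ⊆ Cgam q γ ∪ Cgam q δ ↔ ∀ v ∈ W, Fgam q γ v = 0 ∨ Fgam q δ v = 0 := by
  constructor
  · intro h v hv
    rcases eq_or_ne v 0 with rfl | hv0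
    · simp [H.Fgam_eq, herm, gramDet, H.half_ne_zero]
    · exact (h ((mk_mem_pointSet hv0).2 hv)).imp (fun h => h v hv0 rfl) (fun h => h v hv0 rfl)
  · exact fun h P hP => (h _ hP).imp H.mem_Cgam.2 H.mem_Cgam.2

lemma setOf_lines (H : IsParamPair σ q γ δ) :
    {ℓ : Set (PGPoint F) | IsLine ℓ ∧ ℓ ⊆ Cgam q γ ∪ Cgam q δ} =
      pointSet '' lineSpaces q γ δ := by
  ext ℓ
  constructor
  · rintro ⟨⟨W, hW, rfl⟩, h⟩
    exact ⟨W, ⟨hW, H.pointSet_subset.1 h⟩, rfl⟩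
  · rintro ⟨W, hW, rfl⟩
    exact ⟨⟨W, hW.1, rfl⟩, H.pointSet_subset.2 hW.2⟩

lemma setOf_lines_through (H : IsParamPair σ q γ δ) (P : PGPoint F) :
    {ℓ : Set (PGPoint F) | IsLine ℓ ∧ ℓ ⊆ Cgam q γ ∪ Cgam q δ ∧ P ∈ ℓ} =
      pointSet '' {W | W ∈ lineSpaces q γ δ ∧ P.rep ∈ W} := by
  ext ℓ
  constructor
  · rintro ⟨⟨W, hW, rfl⟩, h, hP⟩
    exact ⟨W, ⟨⟨hW, H.pointSet_subset.1 h⟩, hP⟩, rfl⟩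
  · rintro ⟨W, hW, rfl⟩
    exact ⟨⟨W, hW.1.1, rfl⟩, H.pointSet_subset.2 hW.1.2, hW.2⟩

lemma gramDet_ne_zero (H : IsParamPair σ q γ δ) {ε : F} {P : PGPoint F}
    (hP : P ∈ Cgam q ε \ Oset F q) : gramDet P.rep ≠ 0 := by
  intro hd
  have h := H.mem_Cgam.1 hP.1
  rw [H.Fgam_eq, hd, zero_pow H.half_ne_zero, mul_zero, sub_zero] at h
  exact hP.2 ((mem_Oset H.conj_eq).2 (eq_smul_veronese H.conj P.rep_nonzero hd h))

lemma ncard_lines [Fintype F] (H : IsParamPair σ q γ δ) :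
    {ℓ : Set (PGPoint F) | IsLine ℓ ∧ ℓ ⊆ Cgam q γ ∪ Cgam q δ}.ncard =
      (q + 1) * (Fintype.card F + 1) := by
  rw [H.setOf_lines, Set.ncard_image_of_injective _ pointSet_injective, H.ncard_lineSpaces]

lemma not_exists_line (H : IsParamPair σ q γ δ) {P : PGPoint F}
    (hP : P ∈ Cgam q γ \ Oset F q) :
    ¬ ∃ ℓ : Set (PGPoint F), IsLine ℓ ∧ ℓ ⊆ Cgam q γ ∪ Cgam q δ ∧ P ∈ ℓ := by
  rintro ⟨ℓ, hℓ⟩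
  have hℓ : ℓ ∈ {ℓ : Set (PGPoint F) | IsLine ℓ ∧ ℓ ⊆ Cgam q γ ∪ Cgam q δ ∧ P ∈ ℓ} := hℓ
  rw [H.setOf_lines_through] at hℓ
  obtain ⟨W, ⟨hW, hPW⟩, -⟩ := hℓ
  exact H.notMem_of_left (H.mem_Cgam.1 hP.1) (H.gramDet_ne_zero hP) hW hPW

lemma ncard_lines_through_right (H : IsParamPair σ q γ δ) {P : PGPoint F}
    (hP : P ∈ Cgam q δ \ Oset F q) :
    {ℓ : Set (PGPoint F) | IsLine ℓ ∧ ℓ ⊆ Cgam q γ ∪ Cgam q δ ∧ P ∈ ℓ}.ncard = 2 := by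
  rw [H.setOf_lines_through, Set.ncard_image_of_injective _ pointSet_injective,
    H.ncard_through_right (H.mem_Cgam.1 hP.1) (H.gramDet_ne_zero hP)]

lemma ncard_lines_through_curve (H : IsParamPair σ q γ δ) {P : PGPoint F}
    (hP : P ∈ Oset F q) :
    {ℓ : Set (PGPoint F) | IsLine ℓ ∧ ℓ ⊆ Cgam q γ ∪ Cgam q δ ∧ P ∈ ℓ}.ncard = q + 1 := by
  obtain ⟨i, m, hm, h⟩ := (mem_Oset H.conj_eq).1 hP
  rw [H.setOf_lines_through, Set.ncard_image_of_injective _ pointSet_injective, h,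
    ncard_through_smul hm, H.ncard_through_veronese]

end IsParamPair

end Projective

/-! ### The two families of parameters -/

section Parameters

variable {F : Type*} [Field F] {σ : F →+* F} {q : ℕ}

lemma mem_tangentRoots (h2 : 2 * ((q + 1) / 2) = q + 1) {w : F} (hw : w ≠ 0) {c : F} :
    c ∈ tangentRoots q (w + w⁻¹) ↔
      (-c) ^ ((q + 1) / 2) = -w ∨ (-c) ^ ((q + 1) / 2) = -w⁻¹ := by
  have hN : c * c ^ q = ((-c) ^ ((q + 1) / 2)) ^ 2 := by
    rw [← pow_mul, mul_comm _ 2, h2, Even.neg_pow ⟨(q + 1) / 2, by omega⟩, pow_succ']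
  rw [tangentRoots, Set.mem_ofPred_eq, hN, ← add_eq_zero_iff_eq_neg, ← add_eq_zero_iff_eq_neg,
    ← mul_eq_zero]
  have : w * w⁻¹ = 1 := mul_inv_cancel₀ hw
  constructor <;> intro h <;> [linear_combination h + this; linear_combination h - this]

lemma mul_conj_eq_sq (hσq : ∀ x, σ x = x ^ q) (h2 : 2 * ((q + 1) / 2) = q + 1) (c : F) :
    c * σ c = (c ^ ((q + 1) / 2)) ^ 2 := by
  rw [hσq, ← pow_mul, mul_comm _ 2, h2, pow_succ']

lemma conj_sq_pow (hσ : IsFiniteConj σ) (hσq : ∀ x, σ x = x ^ q)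
    (h2 : 2 * ((q + 1) / 2) = q + 1) (c : F) :
    σ ((c ^ ((q + 1) / 2)) ^ 2) = (c ^ ((q + 1) / 2)) ^ 2 := by
  rw [← mul_conj_eq_sq hσq h2, map_mul, hσ.invol, mul_comm]

lemma tangentRoots_eq_empty (hσ : IsFiniteConj σ) (hσq : ∀ x, σ x = x ^ q)
    (h2 : 2 * ((q + 1) / 2) = q + 1) {w : F} (hw : w ≠ 0) (h : σ (w ^ 2) ≠ w ^ 2) :
    tangentRoots q (w + w⁻¹) = ∅ := by
  refine Set.eq_empty_of_forall_notMem fun c hc => h ?_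
  have hN := conj_sq_pow hσ hσq h2 (-c)
  rcases (mem_tangentRoots h2 hw).1 hc with h1 | h1
  · rwa [h1, neg_sq] at hN
  · rw [h1, neg_sq, inv_pow, map_inv₀] at hN
    exact inv_injective hN

lemma ncard_neg_pow_eq {m : ℕ} (hm : 0 < m) {ζ : F} (hζ : IsPrimitiveRoot ζ m) {a α : F}
    (ha : a ≠ 0) (hα : α ^ m = a) : {c : F | (-c) ^ m = a}.ncard = m := by
  classical
  have hset : {c : F | (-c) ^ m = a} =
      (fun c => -c) '' ((Polynomial.nthRoots m a).toFinset : Set F) := by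
    ext c
    simp [Polynomial.mem_nthRoots hm]
  rw [hset, Set.ncard_image_of_injective _ neg_injective, Set.ncard_coe_finset,
    Multiset.toFinset_card_of_nodup (hζ.nthRoots_nodup ha), hζ.card_nthRoots,
    if_pos ⟨α, hα⟩]

lemma ncard_tangentRoots [Finite F] (h2 : 2 * ((q + 1) / 2) = q + 1) {ζ : F}
    (hζ : IsPrimitiveRoot ζ ((q + 1) / 2)) {w α : F} (hw : w ≠ 0)
    (hα : α ^ ((q + 1) / 2) = -w) (hw2 : w ^ 2 ≠ 1) :
    (tangentRoots q (w + w⁻¹)).ncard = q + 1 := by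
  have hU : tangentRoots q (w + w⁻¹) = {c | (-c) ^ ((q + 1) / 2) = -w} ∪
      {c | (-c) ^ ((q + 1) / 2) = -w⁻¹} := by
    ext c
    exact mem_tangentRoots h2 hw
  have hm : 0 < (q + 1) / 2 := by omega
  rw [hU, Set.ncard_union_eq _ (Set.toFinite _) (Set.toFinite _),
    ncard_neg_pow_eq hm hζ (neg_ne_zero.2 hw) hα,
    ncard_neg_pow_eq hm hζ (neg_ne_zero.2 (inv_ne_zero hw)) (α := α⁻¹)
      (by rw [inv_pow, hα, inv_neg])]
  · omega
  · refine Set.disjoint_left.2 fun c (h : _ = _) (h' : _ = _) => hw2 ?_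
    have : w = w⁻¹ := neg_injective (h.symm.trans h')
    nth_rewrite 1 [sq, this]
    exact inv_mul_cancel₀ hw

lemma isIsotropic_of_hyperbolic (hσ : IsFiniteConj σ) (hσq : ∀ x, σ x = x ^ q)
    (h2 : 2 * ((q + 1) / 2) = q + 1) {w : F} (hw : w ≠ 0) (hw2 : w ^ 2 ≠ 1)
    (hws : σ (w ^ 2) = w ^ 2) (hδ : w + w⁻¹ ≠ 0) {x : Fin 4 → F} (hd : gramDet x ≠ 0)
    (hx : herm σ x = (w + w⁻¹) * gramDet x ^ ((q + 1) / 2)) : IsIsotropic σ x := by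
  have hy2 := mul_conj_eq_sq hσq h2 (gramDet x)
  have hy0 : gramDet x ^ ((q + 1) / 2) ≠ 0 := pow_ne_zero _ hd
  have hh := conj_herm hσ x
  have hsd : σ (gramDet x) ≠ 0 := (map_ne_zero σ).2 hd
  generalize gramDet x ^ ((q + 1) / 2) = y at *
  obtain ⟨u, hu, hl⟩ := exists_eigenvector hσ x (l := w * y / σ (gramDet x)) (by
    rw [hx]
    field_simp
    linear_combination hy2)
  refine ⟨u, hu, ?_⟩
  by_contra hz
  have h1 := hl u
  have h3 := congrArg σ h1
  rw [map_mul, map_div₀, map_mul, hσ.invol, hσ.invol] at h3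
  have hprod : σ w * σ y = w * y := by
    rw [hx, map_mul, map_add, map_inv₀] at hh
    rw [map_pow] at hws
    rcases sq_eq_sq_iff_eq_or_eq_neg.1 hws with h | h
    · rw [h] at hh ⊢
      rw [mul_left_cancel₀ hδ hh]
    · rw [h] at hh ⊢
      rw [inv_neg] at hh
      have h4 : -σ y = y := mul_left_cancel₀ hδ (by linear_combination hh)
      linear_combination w * h4
  rw [hprod] at h3
  rw [h3] at h1
  field_simp at h1
  refine hw2 (mul_right_cancel₀ (pow_ne_zero 2 hy0) ?_)
  linear_combination hy2 - h1

lemma isParamPair_of_generator [Fintype F] (hσ : IsFiniteConj σ) (hσq : ∀ x, σ x = x ^ q)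
    (hq : Odd q) {ξ : F} (hξ : IsPrimitiveRoot ξ (q ^ 2 - 1)) {j k : ℕ}
    (hj1 : 1 ≤ j) (hjq : j ≤ q) (hjne : j ≠ (q + 1) / 2)
    (hk1 : 1 ≤ k) (hkq : k ≤ q - 2) (hkne : k ≠ (q - 1) / 2) :
    IsParamPair σ q (ξ ^ (j * (q - 1) / 2) + (ξ ^ (j * (q - 1) / 2))⁻¹)
      (ξ ^ (k * (q + 1) / 2) + (ξ ^ (k * (q + 1) / 2))⁻¹) := by
  obtain ⟨r, rfl⟩ := hq
  have hm : (2 * r + 1 + 1) / 2 = r + 1 := by omega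
  have h2 : 2 * ((2 * r + 1 + 1) / 2) = 2 * r + 1 + 1 := by omega
  have hr : (2 * r + 1 - 1) / 2 = r := by omega
  have hje : j * (2 * r + 1 - 1) / 2 = j * r := by
    rw [Nat.add_sub_cancel, mul_left_comm, Nat.mul_div_cancel_left _ two_pos]
  have hke : k * (2 * r + 1 + 1) / 2 = k * (r + 1) := by
    rw [show k * (2 * r + 1 + 1) = 2 * (k * (r + 1)) by ring,
      Nat.mul_div_cancel_left _ two_pos]
  have hord : (2 * r + 1) ^ 2 - 1 = 4 * r * (r + 1) := by
    rw [show (2 * r + 1) ^ 2 = 4 * r * (r + 1) + 1 by ring, Nat.add_sub_cancel]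
  have hr0 : 0 < r := by omega
  rw [hord] at hξ
  rw [hr] at hkne
  rw [hm] at hjne
  have hξ0 : ξ ≠ 0 := hξ.ne_zero (by positivity)
  rw [hje, hke]
  have hell : σ ((ξ ^ (j * r)) ^ 2) ≠ (ξ ^ (j * r)) ^ 2 := by
    intro h
    have h1 : ξ ^ (4 * r * (r * j)) = 1 := by
      rw [hσq] at h
      apply mul_right_cancel₀ (pow_ne_zero 2 (pow_ne_zero (j * r) hξ0))
      rw [one_mul]
      refine Eq.trans ?_ h
      ring
    have h3 := Nat.dvd_of_mul_dvd_mul_left (by positivity) (hξ.dvd_of_pow_eq_one _ h1)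
    have h4 : r + 1 ∣ j := Nat.Coprime.dvd_of_dvd_mul_left (by simp) h3
    obtain ⟨d, rfl⟩ := h4
    have : d < 2 := by
      by_contra! hd
      nlinarith
    interval_cases d <;> omega
  have hhyp : (ξ ^ (k * (r + 1))) ^ 2 ≠ 1 := by
    intro h
    have h1 : ξ ^ (2 * (r + 1) * k) = 1 := by rw [← h]; ring
    have h3 := hξ.dvd_of_pow_eq_one _ h1
    rw [show 4 * r * (r + 1) = 2 * (r + 1) * (2 * r) by ring] at h3
    have := Nat.le_of_dvd hk1 (Nat.dvd_of_mul_dvd_mul_left (by positivity) h3)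
    omega
  have hhyp' : (ξ ^ (k * (r + 1))) ^ 2 ≠ -1 := by
    intro h
    have h1 : ξ ^ (4 * (r + 1) * k) = 1 := by
      rw [show 4 * (r + 1) * k = k * (r + 1) * 2 * 2 by ring, pow_mul, pow_mul, h]
      ring
    have h3 := hξ.dvd_of_pow_eq_one _ h1
    rw [show 4 * r * (r + 1) = 4 * (r + 1) * r by ring] at h3
    obtain ⟨d, rfl⟩ := Nat.dvd_of_mul_dvd_mul_left (by positivity) h3
    have : d < 2 := by
      by_contra! hd
      have : r * 2 ≤ r * d := Nat.mul_le_mul_left r hd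
      omega
    interval_cases d <;> omega
  have hws : σ ((ξ ^ (k * (r + 1))) ^ 2) = (ξ ^ (k * (r + 1))) ^ 2 := by
    have := conj_sq_pow hσ hσq h2 (ξ ^ k)
    rwa [hm, ← pow_mul ξ] at this
  have hα : (ξ ^ (k + 2 * r)) ^ (r + 1) = -ξ ^ (k * (r + 1)) := by
    have hneg : ξ ^ (2 * r * (r + 1)) = -1 := by
      have h1 : (ξ ^ (2 * r * (r + 1))) ^ 2 = 1 := by
        rw [← pow_mul, show 2 * r * (r + 1) * 2 = 4 * r * (r + 1) by ring, hξ.pow_eq_one]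
      refine (sq_eq_sq_iff_eq_or_eq_neg.1 (h1.trans (one_pow 2).symm)).resolve_left ?_
      refine hξ.pow_ne_one_of_pos_of_lt (by positivity) ?_
      nlinarith
    rw [← pow_mul, show (k + 2 * r) * (r + 1) = k * (r + 1) + 2 * r * (r + 1) by ring, pow_add,
      hneg, mul_neg_one]
  have hw : ξ ^ (k * (r + 1)) ≠ 0 := pow_ne_zero _ hξ0
  have hv : ξ ^ (j * r) ≠ 0 := pow_ne_zero _ hξ0
  have hζ : IsPrimitiveRoot (ξ ^ (4 * r)) (r + 1) := hξ.pow (by positivity) rfl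
  generalize ξ ^ (k * (r + 1)) = w at *
  generalize ξ ^ (j * r) = v at *
  have hsum : ∀ z : F, z ≠ 0 → z + z⁻¹ = 0 → z ^ 2 = -1 := by
    intro z hz h
    field_simp at h
    linear_combination h
  have hsum' : ∀ z : F, z ≠ 0 → z + z⁻¹ = 2 → z = 1 := by
    intro z hz h
    field_simp at h
    have : (z - 1) ^ 2 = 0 := by linear_combination h
    exact sub_eq_zero.1 (pow_eq_zero_iff two_ne_zero |>.1 this)
  refine ⟨hσ, hσq, ⟨r, rfl⟩, fun h => hell ?_, fun h => hhyp' (hsum w hw h), fun h => hell ?_,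
    fun h => hhyp ?_, tangentRoots_eq_empty hσ hσq h2 hv hell,
    ncard_tangentRoots h2 (hm.symm ▸ hζ) hw (hm.symm ▸ hα) hhyp, fun c hc h => hhyp ?_,
    fun x hx hd => ?_⟩
  · rw [hsum v hv h, map_neg, map_one]
  · rw [hsum' v hv h, one_pow, map_one]
  · rw [hsum' w hw h, one_pow]
  · have hN := mul_conj_eq_sq hσq h2 (-c)
    rw [map_neg, neg_mul_neg, h] at hN
    rcases (mem_tangentRoots h2 hw).1 hc with h1 | h1 <;> rw [h1, neg_sq] at hN
    · exact hN.symm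
    · rwa [inv_pow, eq_comm, inv_eq_one] at hN
  · refine isIsotropic_of_hyperbolic hσ hσq h2 hw hhyp hws (fun h => hhyp' (hsum w hw h)) hd ?_
    simp only [Fgam, ← hσq] at hx
    simp only [herm, gramDet]
    rw [pow_succ' (x 1), pow_succ' (x 2), ← hσq, ← hσq] at hx
    linear_combination hx

end Parameters

/-- Proposition 3.5 and Proposition 4.1 for `V₄ = S_j ∪ E_k`: there are exactly
    `(q+1)(q²+1)` lines contained in `V₄`; no such line passes through a point of
    `S_j \ O`, exactly two pass through each point of `E_k \ O`, and exactly `q+1`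
    pass through each point of `O`. Moreover `G ≅ PGL(2,q²)` has exactly `q+4`
    orbits on the points of `PG(3,q²)`. -/
theorem stmt19 {F : Type*} [Field F] [Fintype F] (p n q : ℕ) (hp : p.Prime)
    (hodd : Odd p) (hn : 0 < n) (hq : q = p ^ n) (hF : Fintype.card F = q ^ 2)
    (ξ : F) (hξ : ∀ x : F, x ≠ 0 → ∃ m : ℕ, x = ξ ^ m)
    (j : ℕ) (hj1 : 1 ≤ j) (hjq : j ≤ q) (hjne : j ≠ (q + 1) / 2)
    (k : ℕ) (hk1 : 1 ≤ k) (hkq : k ≤ q - 2) (hkne : k ≠ (q - 1) / 2) :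
    let Sj : Set (PGPoint F) := Cgam q (ξ ^ (j * (q - 1) / 2) + (ξ ^ (j * (q - 1) / 2))⁻¹)
    let Ek : Set (PGPoint F) := Cgam q (ξ ^ (k * (q + 1) / 2) + (ξ ^ (k * (q + 1) / 2))⁻¹)
    let V : Set (PGPoint F) := Sj ∪ Ek
    ({ℓ : Set (PGPoint F) | IsLine ℓ ∧ ℓ ⊆ V}.ncard = (q + 1) * (q ^ 2 + 1)) ∧
      (∀ P ∈ Sj \ Oset F q,
        ¬ ∃ ℓ : Set (PGPoint F), IsLine ℓ ∧ ℓ ⊆ V ∧ P ∈ ℓ) ∧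
      (∀ P ∈ Ek \ Oset F q,
        {ℓ : Set (PGPoint F) | IsLine ℓ ∧ ℓ ⊆ V ∧ P ∈ ℓ}.ncard = 2) ∧
      (∀ P ∈ Oset F q,
        {ℓ : Set (PGPoint F) | IsLine ℓ ∧ ℓ ⊆ V ∧ P ∈ ℓ}.ncard = q + 1) ∧
      ({S : Set (PGPoint F) | ∃ P : PGPoint F, S = Gorb q P}.ncard = q + 4) := by
  have hq3 : 3 ≤ q := by omega
  obtain ⟨σ, hσq, hσ⟩ := exists_isFiniteConj hp hodd hq hF hq3 hξ
  have H := isParamPair_of_generator hσ hσq (hq ▸ hodd.pow)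
    (isPrimitiveRoot_of_generator hF hq3 hξ) hj1 hjq hjne hk1 hkq hkne
  intro Sj Ek V
  refine ⟨?_, fun P hP => H.not_exists_line hP, fun P hP => H.ncard_lines_through_right hP,
    fun P hP => H.ncard_lines_through_curve hP, ncard_Gorb hσ hσq (ncard_fixed hF hq3 hξ)⟩
  rw [← hF]
  exact H.ncard_lines
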